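/- arXiv:2205.14556 — 8 statements merged into one kernel-verified Lean document; each statement's English description precedes it below -/
import Mathlib

section
/- Let n > k ≥ 4 be integers. Every k-critical graph G on n vertices satisfies t_{k-1}(G) ≤ n - k + 3, i.e., G contains at most n - k + 3 copies of the complete graph on k-1 vertices. -/
open SimpleGraph

/-- The number of copies of the clique `K_ℓ` in `G`: the number of `ℓ`-element
vertex subsets inducing a complete subgraph. -/
noncomputable def cliqueCount {V : Type*} (G : SimpleGraph V) (ℓ : ℕ) : ℕ :=
  {s : Finset V | G.IsNClique ℓ s}.ncard

/-- `G` is `k`-critical: its chromatic number is `k`, but every proper subgraph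
has chromatic number less than `k`. -/
def IsCritical {V : Type*} (G : SimpleGraph V) (k : ℕ) : Prop :=
  G.chromaticNumber = k ∧ ∀ H : G.Subgraph, H ≠ ⊤ → H.coe.chromaticNumber < k

/-- If every edge indicator, as a function on `r`-cliques, is a linear combination of vertex
indicators, then so is the indicator of containing any given vertex set. -/
theorem exists_weight_of_subset {V : Type*} [Fintype V] [DecidableEq V] {G : SimpleGraph V} {r : ℕ}
    (hr : 0 < r)
    (hE : ∀ u v, G.Adj u v → ∃ f : V → ℚ, ∀ Q, G.IsNClique r Q →
      ∑ a ∈ Q, f a = if u ∈ Q ∧ v ∈ Q then 1 else 0) (S : Finset V) :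
    ∃ f : V → ℚ, ∀ Q, G.IsNClique r Q → ∑ a ∈ Q, f a = if S ⊆ Q then 1 else 0 := by
  induction S using Finset.induction_on with
  | empty =>
    refine ⟨fun _ => 1 / r, fun Q hQ => ?_⟩
    have : (r : ℚ) ≠ 0 := by positivity
    simp [hQ.card_eq, this]
  | insert a S _ ih =>
    obtain ⟨f, hf⟩ := ih
    have hex : ∀ u, ∃ h : V → ℚ, ∀ Q, G.IsNClique r Q →
        ∑ b ∈ Q, h b = if a ∈ Q ∧ u ∈ Q then 1 else 0 := by
      intro u
      by_cases hau : a = u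
      · subst hau
        exact ⟨Pi.single a 1, fun Q _ => by simp⟩
      by_cases hadj : G.Adj a u
      · exact hE a u hadj
      · refine ⟨0, fun Q hQ => ?_⟩
        have : ¬ (a ∈ Q ∧ u ∈ Q) := fun h => hadj (hQ.isClique h.1 h.2 hau)
        simp [this]
    choose h hh using hex
    refine ⟨fun b => ∑ u, f u * h u b, fun Q hQ => ?_⟩
    rw [Finset.sum_comm]
    simp_rw [← Finset.mul_sum, hh _ Q hQ]
    have := hf Q hQ
    by_cases ha : a ∈ Q
    · simp only [ha, true_and, mul_ite, mul_one, mul_zero, Finset.sum_ite_mem, Finset.univ_inter,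
        Finset.insert_subset_iff, this]
    · simp [ha, Finset.insert_subset_iff]

/-- Under the same hypothesis the clique vectors are linearly independent, so linearly independent
vectors orthogonal to all of them improve the dimension bound. -/
theorem ncard_cliques_add_card_le {V : Type*} [Fintype V] [DecidableEq V] {G : SimpleGraph V}
    {r : ℕ} (hr : 0 < r)
    (hE : ∀ u v, G.Adj u v → ∃ f : V → ℚ, ∀ Q, G.IsNClique r Q →
      ∑ a ∈ Q, f a = if u ∈ Q ∧ v ∈ Q then 1 else 0)
    (R : Finset V) (p : V → V → ℚ)
    (hp : ∀ u ∈ R, ∀ Q, G.IsNClique r Q → ∑ a ∈ Q, p u a = 0)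
    (hli : LinearIndependent ℚ (fun u : R => p u)) :
    {s : Finset V | G.IsNClique r s}.ncard + R.card ≤ Fintype.card V := by
  classical
  let T : Type _ := {s : Finset V // G.IsNClique r s}
  let F : (V → ℚ) →ₗ[ℚ] (T → ℚ) :=
    LinearMap.pi fun Q => ∑ a ∈ Q.1, LinearMap.proj a
  have hF : ∀ f Q, F f Q = ∑ a ∈ Q.1, f a := by intro f Q; simp [F]
  have hsurj : Function.Surjective F := by
    choose f hf using fun Q : T => exists_weight_of_subset hr hE Q.1
    intro g
    refine ⟨∑ Q, g Q • f Q, ?_⟩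
    ext Q'
    rw [map_sum, Finset.sum_apply, Finset.sum_eq_single Q']
    · simp [hF, ← Finset.mul_sum, hf Q' Q'.1 Q'.2]
    · intro Q _ hne
      have : ¬ Q.1 ⊆ Q'.1 := fun h => hne (Subtype.ext
        (Finset.eq_of_subset_of_card_le h (by rw [Q.2.card_eq, Q'.2.card_eq])))
      simp [hF, ← Finset.mul_sum, hf Q Q'.1 Q'.2, this]
    · simp
  have hrank := F.finrank_range_add_finrank_ker
  rw [LinearMap.range_eq_top.2 hsurj, finrank_top, Module.finrank_fintype_fun_eq_card,
    Module.finrank_fintype_fun_eq_card] at hrank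
  have hker : R.card ≤ Module.finrank ℚ (LinearMap.ker F) := by
    have hmem : ∀ u : R, p u ∈ LinearMap.ker F := fun u => by
      rw [LinearMap.mem_ker]; ext Q; simp [hF, hp u u.2 Q.1 Q.2]
    have hli' : LinearIndependent ℚ (fun u : R => (⟨p u, hmem u⟩ : LinearMap.ker F)) :=
      LinearIndependent.of_comp (LinearMap.ker F).subtype hli
    simpa using hli'.fintype_card_le_finrank
  have hT : {s : Finset V | G.IsNClique r s}.ncard = Fintype.card T := by
    rw [← Nat.card_coe_set_eq, Nat.card_eq_fintype_card]; rfl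
  omega

/-- A matrix whose rows are those of the identity shifted by constants of total less than one
is nonsingular. -/
theorem linearIndependent_of_restrict {V : Type*} [DecidableEq V] (R : Finset V) (p : V → V → ℚ)
    (c : V → ℚ) (hc : ∑ u ∈ R, c u < 1)
    (hp : ∀ u ∈ R, ∀ w ∈ R, p u w = (if u = w then 1 else 0) - c u) :
    LinearIndependent ℚ (fun u : R => p u) := by
  rw [Fintype.linearIndependent_iff]
  intro a ha
  have key : ∀ w : R, a w = ∑ u : R, a u * c u := by
    intro w
    have h := congrFun ha w.1
    simp only [Finset.sum_apply, Pi.smul_apply, smul_eq_mul, Pi.zero_apply] at h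
    have : ∀ u : R, a u * p u w = (if u = w then a u else 0) - a u * c u := by
      intro u
      rw [hp u u.2 w w.2]
      by_cases huw : u = w
      · simp [huw, mul_sub]
      · have : u.1 ≠ w.1 := fun h => huw (Subtype.ext h)
        simp [huw, this]
    simp_rw [this, Finset.sum_sub_distrib] at h
    simpa [sub_eq_zero] using h
  set s := ∑ u : R, a u * c u with hs
  have h1 : s = s * ∑ u ∈ R, c u := by
    rw [hs]
    conv_lhs => rw [Finset.sum_congr rfl (fun u _ => by rw [key u])]
    rw [← Finset.mul_sum, Finset.sum_coe_sort R c]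
  have h2 : s = 0 := by
    have : s * (1 - ∑ u ∈ R, c u) = 0 := by linarith
    rcases mul_eq_zero.1 this with h | h
    · exact h
    · linarith
  intro w
  rw [key w, h2]

/-- A colouring of `G` whose only monochromatic edge is `uv`. -/
def IsNearColoring {V C : Type*} (G : SimpleGraph V) (u v : V) (φ : V → C) : Prop :=
  φ u = φ v ∧ ∀ a b, G.Adj a b → φ a = φ b → s(a, b) = s(u, v)

theorem IsCritical.not_colorable {V : Type*} {G : SimpleGraph V} {k : ℕ} (hG : IsCritical G k)
    (hk : 0 < k) : ¬ G.Colorable (k - 1) := by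
  intro h
  have h1 := chromaticNumber_le_iff_colorable.2 h
  rw [hG.1] at h1
  have : k ≤ k - 1 := by exact_mod_cast h1
  omega

theorem IsCritical.colorable_of_ne_top {V : Type*} {G : SimpleGraph V} {k : ℕ}
    (hG : IsCritical G k) (hk : 0 < k) {H : G.Subgraph} (hH : H ≠ ⊤) :
    H.coe.Colorable (k - 1) := by
  rw [← chromaticNumber_le_iff_colorable]
  have h := hG.2 H hH
  have hk' : ((k : ℕ) : ℕ∞) = ((k - 1 : ℕ) : ℕ∞) + 1 := by
    norm_cast; omega
  rw [hk'] at h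
  exact Order.le_of_lt_add_one h

theorem IsCritical.exists_isNearColoring {V : Type*} {G : SimpleGraph V} {k : ℕ}
    (hG : IsCritical G k) (hk : 0 < k) {u v : V} (huv : G.Adj u v) :
    ∃ φ : V → Fin (k - 1), IsNearColoring G u v φ := by
  let H : G.Subgraph := (⊤ : G.Subgraph).deleteEdges {s(u, v)}
  have hH : H ≠ ⊤ := by
    intro h
    have : H.Adj u v := by rw [h]; exact huv
    simp [H] at this
  obtain ⟨C⟩ := hG.colorable_of_ne_top hk hH
  have hv : ∀ a, a ∈ H.verts := fun a => by simp [H]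
  have hC : ∀ a b, G.Adj a b → C ⟨a, hv a⟩ = C ⟨b, hv b⟩ → s(a, b) = s(u, v) := by
    intro a b hab hc
    by_contra hne
    refine C.valid (v := ⟨a, hv a⟩) (w := ⟨b, hv b⟩) ?_ hc
    change H.Adj a b
    simp only [H, Subgraph.deleteEdges_adj, Subgraph.top_adj, Set.mem_singleton_iff]
    exact ⟨hab, hne⟩
  refine ⟨fun a => C ⟨a, hv a⟩, ?_, hC⟩
  by_contra hne
  refine hG.not_colorable hk ⟨Coloring.mk (fun a => C ⟨a, hv a⟩) ?_⟩
  intro a b hab hc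
  rcases Sym2.eq_iff.1 (hC a b hab hc) with ⟨rfl, rfl⟩ | ⟨rfl, rfl⟩
  · exact hne hc
  · exact hne hc.symm

theorem IsCritical.cliqueFree {V : Type*} [Fintype V] {G : SimpleGraph V} {k : ℕ}
    (hG : IsCritical G k) (hk : 0 < k) (hn : k < Fintype.card V) : G.CliqueFree k := by
  intro S hS
  let H : G.Subgraph := (⊤ : G.Subgraph).induce (S : Set V)
  have hH : H ≠ ⊤ := by
    intro h
    have h1 : S = Finset.univ := by
      ext a
      have : a ∈ H.verts := by rw [h]; trivial
      simpa [H] using this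
    have := hS.card_eq
    rw [h1, Finset.card_univ] at this
    omega
  obtain ⟨C⟩ := hG.colorable_of_ne_top hk hH
  have hinj : Function.Injective (fun a : S => C ⟨a.1, a.2⟩) := by
    intro a b hab
    by_contra hne
    have hne' : a.1 ≠ b.1 := fun h => hne (Subtype.ext h)
    refine C.valid (v := ⟨a.1, a.2⟩) (w := ⟨b.1, b.2⟩) ?_ hab
    change H.Adj a.1 b.1
    simp only [H, Subgraph.induce_adj, Subgraph.top_adj]
    exact ⟨a.2, b.2, hS.isClique a.2 b.2 hne'⟩
  have := Fintype.card_le_of_injective _ hinj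
  simp [hS.card_eq] at this
  omega

theorem IsNearColoring.injOn {V C : Type*} {G : SimpleGraph V} {u v : V} {φ : V → C}
    (hφ : IsNearColoring G u v φ) {Q : Finset V} (hQ : G.IsClique (Q : Set V))
    (huv : ¬ (u ∈ Q ∧ v ∈ Q)) : Set.InjOn φ Q := by
  intro a ha b hb hab
  by_contra hne
  rcases Sym2.eq_iff.1 (hφ.2 a b (hQ ha hb hne) hab) with ⟨rfl, rfl⟩ | ⟨rfl, rfl⟩
  · exact huv ⟨ha, hb⟩
  · exact huv ⟨hb, ha⟩

/-- A clique of size `r` not containing `uv` meets each class of the near-colouring once. -/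
theorem IsNearColoring.card_filter {V : Type*} {G : SimpleGraph V} {u v : V} {r : ℕ}
    {φ : V → Fin r} (hφ : IsNearColoring G u v φ) {Q : Finset V} (hQ : G.IsNClique r Q)
    (huv : ¬ (u ∈ Q ∧ v ∈ Q)) (c : Fin r) : (Q.filter (fun a => φ a = c)).card = 1 := by
  classical
  have hinj := hφ.injOn hQ.isClique huv
  have himg : Q.image φ = Finset.univ := by
    rw [← Finset.card_eq_iff_eq_univ, Finset.card_image_of_injOn hinj, hQ.card_eq, Fintype.card_fin]
  obtain ⟨a, ha, hac⟩ := Finset.mem_image.1 (himg ▸ Finset.mem_univ c : c ∈ Q.image φ)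
  rw [Finset.card_eq_one]
  refine ⟨a, ?_⟩
  ext b
  simp only [Finset.mem_filter, Finset.mem_singleton]
  constructor
  · rintro ⟨hb, hbc⟩
    exact hinj hb ha (hbc.trans hac.symm)
  · rintro rfl
    exact ⟨ha, hac⟩

theorem sum_class_weight {V : Type*} {r : ℕ} (hr : 0 < r) (φ : V → Fin r)
    (c : Fin r) {Q : Finset V} (hQ : Q.card = r) :
    ∑ a ∈ Q, ((if φ a = c then 1 else 0) - 1 / r : ℚ) =
      (Q.filter (fun a => φ a = c)).card - 1 := by
  have : (r : ℚ) ≠ 0 := by positivity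
  simp [Finset.sum_sub_distrib, hQ, this]

/-- The colour class of the monochromatic edge `uv`, centred, represents the indicator of `uv`
on cliques. -/
theorem IsNearColoring.exists_edge_weight {V : Type*} [DecidableEq V] {G : SimpleGraph V}
    {u v : V} {r : ℕ} (hr : 0 < r) (huv : G.Adj u v) {φ : V → Fin r}
    (hφ : IsNearColoring G u v φ) :
    ∃ f : V → ℚ, (∀ Q, G.IsNClique r Q → ∑ a ∈ Q, f a = if u ∈ Q ∧ v ∈ Q then 1 else 0) ∧
      f u = 1 - 1 / r ∧ f v = 1 - 1 / r ∧ ∀ w, G.Adj u w → w ≠ v → f w = -(1 / r) := by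
  refine ⟨fun a => (if φ a = φ u then 1 else 0) - 1 / r, ?_, by simp, by simp [hφ.1], ?_⟩
  · intro Q hQ
    rw [sum_class_weight hr φ (φ u) hQ.card_eq]
    split_ifs with h
    · have : Q.filter (fun a => φ a = φ u) = {u, v} := by
        ext a
        simp only [Finset.mem_filter, Finset.mem_insert, Finset.mem_singleton]
        constructor
        · rintro ⟨ha, hac⟩
          by_contra! hne
          have := hφ.2 a u (hQ.isClique ha h.1 hne.1) hac
          rcases Sym2.eq_iff.1 this with ⟨h1, -⟩ | ⟨h1, -⟩
          · exact hne.1 h1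
          · exact hne.2 h1
        · rintro (rfl | rfl)
          · exact ⟨h.1, rfl⟩
          · exact ⟨h.2, hφ.1.symm⟩
      rw [this, Finset.card_pair huv.ne]
      norm_num
    · rw [hφ.card_filter hQ h]
      norm_num
  · intro w huw hwv
    have : φ w ≠ φ u := by
      intro h
      rcases Sym2.eq_iff.1 (hφ.2 u w huw h.symm) with ⟨-, h1⟩ | ⟨h1, -⟩
      · exact hwv h1
      · exact huv.ne h1
    simp [this]

/-- A vertex of degree more than `r` yields a vector orthogonal to all `r`-cliques with prescribed
entries on the closed neighbourhood of that vertex. -/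
theorem exists_orthogonal_of_lt_degree {V : Type*} [Fintype V] [DecidableEq V]
    {G : SimpleGraph V} [DecidableRel G.Adj] {r : ℕ} (hr : 0 < r)
    (hE : ∀ u v, G.Adj u v → ∃ f : V → ℚ,
      (∀ Q, G.IsNClique r Q → ∑ a ∈ Q, f a = if u ∈ Q ∧ v ∈ Q then 1 else 0) ∧
      f u = 1 - 1 / r ∧ f v = 1 - 1 / r ∧ ∀ w, G.Adj u w → w ≠ v → f w = -(1 / r))
    (u : V) (hu : r < G.degree u) :
    ∃ g : V → ℚ, (∀ Q, G.IsNClique r Q → ∑ a ∈ Q, g a = 0) ∧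
      g u = 1 - 1 / r ∧ ∀ w, G.Adj u w → g w = -(1 / r) := by
  have hr0 : (r : ℚ) ≠ 0 := by positivity
  choose! f hf1 hf2 hf3 hf4 using hE u
  have hd : (r : ℚ) < G.degree u := by exact_mod_cast hu
  have hd' : (G.degree u : ℚ) - r ≠ 0 := by linarith
  refine ⟨fun a => (1 / (G.degree u - r)) *
    (∑ v ∈ G.neighborFinset u, f v a - (r - 1) * if a = u then 1 else 0), ?_, ?_, ?_⟩
  · intro Q hQ
    rw [← Finset.mul_sum, Finset.sum_sub_distrib, Finset.sum_comm, ← Finset.mul_sum,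
      Finset.sum_ite_eq' Q u]
    rw [Finset.sum_congr rfl (fun v hv => hf1 v (by simpa using hv) Q hQ)]
    by_cases h : u ∈ Q
    · have : (G.neighborFinset u).filter (fun v => v ∈ Q) = Q.erase u := by
        ext v
        simp only [Finset.mem_filter, mem_neighborFinset, Finset.mem_erase]
        exact ⟨fun hv => ⟨hv.1.ne', hv.2⟩, fun hv => ⟨hQ.isClique h hv.2 hv.1.symm, hv.2⟩⟩
      simp only [h, true_and, Finset.sum_boole, this, Finset.card_erase_of_mem h, hQ.card_eq]
      rw [Nat.cast_sub hr]
      simp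
    · simp [h]
  · dsimp only
    rw [Finset.sum_congr rfl (fun v hv => hf2 v (by simpa using hv))]
    simp only [Finset.sum_const, card_neighborFinset_eq_degree, nsmul_eq_mul, if_true]
    field_simp
  · intro w hw
    have hw' : w ∈ G.neighborFinset u := by simpa using hw
    dsimp only
    rw [← Finset.add_sum_erase _ _ hw', hf3 w hw, Finset.sum_congr rfl (g := fun _ => -(1 / r : ℚ))]
    · rw [Finset.sum_const, Finset.card_erase_of_mem hw', card_neighborFinset_eq_degree,
        if_neg hw.ne', nsmul_eq_mul, Nat.cast_sub (by omega)]
      field_simp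
      push_cast
      ring
    · intro v hv
      rw [Finset.mem_erase] at hv
      exact hf4 v (by simpa using hv.2) w hw hv.1.symm

/-- If no edge between two low vertices of an `r`-clique `Q` lies in `Q` only, then any two low
vertices of `Q` lie in the same `r`-cliques, provided there are at least three of them. -/
theorem low_vertices_twins {V : Type*} [Fintype V] [DecidableEq V]
    {G : SimpleGraph V} [DecidableRel G.Adj] {r : ℕ} (hfree : G.CliqueFree (r + 1))
    {Q : Finset V} (hQ : G.IsNClique r Q)
    (hedge : ∀ x ∈ Q, ∀ y ∈ Q, x ≠ y → ∃ Q', G.IsNClique r Q' ∧ x ∈ Q' ∧ y ∈ Q' ∧ Q' ≠ Q)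
    {x y : V} (hx : x ∈ Q) (hy : y ∈ Q) (hxy : x ≠ y) (hdx : G.degree x ≤ r)
    (hdy : G.degree y ≤ r) {Q' : Finset V} (hQ' : G.IsNClique r Q') (hxQ' : x ∈ Q') : y ∈ Q' := by
  have houtside : ∀ z ∈ Q, G.degree z ≤ r → ∀ w, G.Adj z w → w ∉ Q →
      ∀ a, G.Adj z a → a ∈ insert w Q := by
    intro z hz hdz w hzw hwQ a hza
    by_contra ha
    have hsub : insert a (insert w (Q.erase z)) ⊆ G.neighborFinset z := by
      intro b hb
      simp only [Finset.mem_insert, Finset.mem_erase] at hb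
      rw [mem_neighborFinset]
      rcases hb with rfl | rfl | ⟨hbz, hbQ⟩
      · exact hza
      · exact hzw
      · exact hQ.isClique hz hbQ hbz.symm
    have hcard := Finset.card_le_card hsub
    simp only [Finset.mem_insert, not_or] at ha
    rw [Finset.card_insert_of_notMem, Finset.card_insert_of_notMem,
      Finset.card_erase_of_mem hz, hQ.card_eq, card_neighborFinset_eq_degree] at hcard
    · have : 0 < Q.card := Finset.card_pos.2 ⟨z, hz⟩
      rw [hQ.card_eq] at this
      omega
    · simp [hwQ]
    · simp [ha]
  obtain ⟨Q₁, hQ₁, hxQ₁, hyQ₁, hne⟩ := hedge x hx y hy hxy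
  obtain ⟨w, hwQ₁, hwQ⟩ : ∃ w ∈ Q₁, w ∉ Q := by
    by_contra! h
    exact hne (Finset.eq_of_subset_of_card_le h (by rw [hQ.card_eq, hQ₁.card_eq]))
  have hxw : G.Adj x w := hQ₁.isClique hxQ₁ hwQ₁ (by rintro rfl; exact hwQ hx)
  have hyw : G.Adj y w := hQ₁.isClique hyQ₁ hwQ₁ (by rintro rfl; exact hwQ hy)
  obtain ⟨q, hq, hwq⟩ : ∃ q ∈ Q, ¬ G.Adj w q := by
    by_contra! h
    exact hfree _ (hQ.insert h)
  by_contra hyQ'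
  have hsub : Q' ⊆ (insert w Q).erase y := by
    intro a ha
    rw [Finset.mem_erase]
    refine ⟨by rintro rfl; exact hyQ' ha, ?_⟩
    by_cases hax : a = x
    · subst hax; exact Finset.mem_insert_of_mem hx
    · exact houtside x hx hdx w hxw hwQ a (hQ'.isClique hxQ' ha (Ne.symm hax))
  have heq := Finset.eq_of_subset_of_card_le hsub (by
    rw [Finset.card_erase_of_mem (Finset.mem_insert_of_mem hy), Finset.card_insert_of_notMem hwQ,
      hQ.card_eq, hQ'.card_eq]
    omega)
  refine hwq (hQ'.isClique (x := w) (y := q) ?_ ?_ ?_)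
  · simp [heq, hyw.ne']
  · have : q ≠ y := by rintro rfl; exact hwq hyw.symm
    simp [heq, this, hq]
  · rintro rfl; exact hwQ hq

/-- Tight bound towards Gallai's conjecture: for `n > k ≥ 4`, every `k`-critical
graph on `n` vertices contains at most `n - k + 3` copies of `K_{k-1}`. -/
theorem gallai_tight_bound {V : Type*} [Fintype V] {n k : ℕ} (hk : 4 ≤ k) (hn : k < n)
    (hcard : Fintype.card V = n) (G : SimpleGraph V) (hG : IsCritical G k) :
    cliqueCount G (k - 1) ≤ n - k + 3 := by
  classical
  obtain ⟨r, rfl⟩ : ∃ r, k = r + 1 := ⟨k - 1, by omega⟩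
  have hr : 0 < r := by omega
  have hr0 : (0 : ℚ) < r := by exact_mod_cast hr
  have hfree := hG.cliqueFree (by omega) (hcard ▸ hn)
  have hcol : ∀ u v, G.Adj u v → ∃ φ : V → Fin r, IsNearColoring G u v φ :=
    fun u v h => hG.exists_isNearColoring (by omega) h
  have hE := fun u v (h : G.Adj u v) => (hcol u v h).elim fun φ hφ => hφ.exists_edge_weight hr h
  rw [cliqueCount, Nat.add_sub_cancel]
  by_cases hne : ∃ Q, G.IsNClique r Q
  swap
  · have : {s : Finset V | G.IsNClique r s} = ∅ := by
      ext s; simpa using fun h => hne ⟨s, h⟩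
    simp [this]
  obtain ⟨Q, hQ⟩ := hne
  suffices ∃ (R : Finset V) (p : V → V → ℚ) (c : V → ℚ), R.card = r - 2 ∧ (∀ u, c u ≤ 1 / r) ∧
      (∀ u ∈ R, ∀ Q, G.IsNClique r Q → ∑ a ∈ Q, p u a = 0) ∧
      ∀ u ∈ R, ∀ w ∈ R, p u w = (if u = w then 1 else 0) - c u by
    obtain ⟨R, p, c, hR, hc, hp, hpc⟩ := this
    have hsum : ∑ u ∈ R, c u < 1 := by
      refine (Finset.sum_le_sum fun u _ => hc u).trans_lt ?_
      have : (R.card : ℚ) < r := by exact_mod_cast (by omega : R.card < r)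
      rw [Finset.sum_const, nsmul_eq_mul, mul_one_div, div_lt_one hr0]
      exact this
    have := ncard_cliques_add_card_le hr (fun u v h => (hE u v h).imp fun _ hf => hf.1) R p hp
      (linearIndependent_of_restrict R p c hsum hpc)
    omega
  by_cases hedge : ∀ x ∈ Q, ∀ y ∈ Q, x ≠ y → ∃ Q', G.IsNClique r Q' ∧ x ∈ Q' ∧ y ∈ Q' ∧ Q' ≠ Q
  swap
  · push Not at hedge
    obtain ⟨x, hx, y, hy, hxy, huniq⟩ := hedge
    obtain ⟨φ, hφ⟩ := hcol x y (hQ.isClique hx hy hxy)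
    have hsep : ∀ u ∈ (Q.erase x).erase y, ∀ w ∈ Q, φ w = φ u → w = u := by
      intro u hu w hw hwu
      simp only [Finset.mem_erase] at hu
      by_contra hne
      rcases Sym2.eq_iff.1 (hφ.2 w u (hQ.isClique hw hu.2.2 hne) hwu) with ⟨-, h⟩ | ⟨-, h⟩
      · exact hu.1 h
      · exact hu.2.1 h
    refine ⟨(Q.erase x).erase y, fun u a => (if φ a = φ u then 1 else 0) - 1 / r, fun _ => 1 / r,
      ?_, fun _ => le_rfl, ?_, ?_⟩
    · rw [Finset.card_erase_of_mem (Finset.mem_erase.2 ⟨hxy.symm, hy⟩), Finset.card_erase_of_mem hx,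
        hQ.card_eq]
      omega
    · intro u hu Q' hQ'
      rw [sum_class_weight hr φ (φ u) hQ'.card_eq]
      by_cases h : x ∈ Q' ∧ y ∈ Q'
      · obtain rfl := huniq Q' hQ' h.1 h.2
        have hu' : u ∈ Q' := Finset.mem_of_mem_erase (Finset.mem_of_mem_erase hu)
        have : Q'.filter (fun a => φ a = φ u) = {u} := by
          ext a
          simp only [Finset.mem_filter, Finset.mem_singleton]
          exact ⟨fun ha => hsep u hu a ha.1 ha.2, by rintro rfl; exact ⟨hu', rfl⟩⟩
        simp [this]
      · simp [hφ.card_filter hQ' h]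
    · intro u hu w hw
      have : φ w = φ u ↔ u = w :=
        ⟨fun h => (hsep u hu w (Finset.mem_of_mem_erase (Finset.mem_of_mem_erase hw)) h).symm,
          by rintro rfl; rfl⟩
      simp [this]
  choose! g hg1 hg2 hg3 using exists_orthogonal_of_lt_degree hr hE
  have hg : ∀ u ∈ Q, r < G.degree u → ∀ w ∈ Q, g u w = (if u = w then 1 else 0) - 1 / r := by
    intro u hu hdu w hw
    split_ifs with h
    · rw [← h, hg2 u hdu]
    · rw [hg3 u hdu w (hQ.isClique hu hw h), zero_sub]
  by_cases hlow : ∃ x ∈ Q, G.degree x ≤ r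
  · obtain ⟨x, hx, hdx⟩ := hlow
    obtain ⟨R, hRQ, hR⟩ := Finset.exists_subset_card_eq (s := Q.erase x) (n := r - 2)
      (by rw [Finset.card_erase_of_mem hx, hQ.card_eq]; omega)
    refine ⟨R, fun u => if r < G.degree u then g u else Pi.single u 1 - Pi.single x 1,
      fun u => if r < G.degree u then 1 / r else 0, hR, ?_, ?_, ?_⟩
    · intro u
      dsimp only
      split_ifs
      · exact le_rfl
      · positivity
    · intro u hu Q' hQ'
      dsimp only
      split_ifs with hdu
      · exact hg1 u hdu Q' hQ'
      · have hu' := Finset.mem_erase.1 (hRQ hu)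
        have : u ∈ Q' ↔ x ∈ Q' :=
          ⟨low_vertices_twins hfree hQ hedge hu'.2 hx hu'.1 (not_lt.1 hdu) hdx hQ',
            low_vertices_twins hfree hQ hedge hx hu'.2 hu'.1.symm hdx (not_lt.1 hdu) hQ'⟩
        simp [this]
    · intro u hu w hw
      have hu' := Finset.mem_erase.1 (hRQ hu)
      have hw' := Finset.mem_erase.1 (hRQ hw)
      dsimp only
      split_ifs with hdu huw huw
      · rw [hg u hu'.2 hdu w hw'.2, if_pos huw]
      · rw [hg u hu'.2 hdu w hw'.2, if_neg huw]
      · subst huw; simp [hw'.1]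
      · simp [hw'.1, Ne.symm huw]
  · push Not at hlow
    obtain ⟨R, hRQ, hR⟩ := Finset.exists_subset_card_eq (s := Q) (n := r - 2)
      (by rw [hQ.card_eq]; omega)
    exact ⟨R, g, fun _ => 1 / r, hR, fun _ => le_rfl, fun u hu => hg1 u (hlow u (hRQ hu)),
      fun u hu w hw => hg u (hRQ hu) (hlow u (hRQ hu)) w (hRQ hw)⟩
end

section
/- Let n > k ≥ 4 be integers. Every k-critical graph G on n vertices satisfies t_{k-1}(G) < n - 3k/5 + 2. -/
open SimpleGraph

/-- `φ` is a colouring of `G` whose only monochromatic edge is `xy`. -/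
def IsColoringExcept {V α : Type*} (G : SimpleGraph V) (x y : V) (φ : V → α) : Prop :=
  φ x = φ y ∧ ∀ u v, G.Adj u v → φ u = φ v → s(u, v) = s(x, y)

section Critical

variable {V : Type*} {G : SimpleGraph V} {m : ℕ}

/-- In a critical graph, a proper subgraph can be coloured with one colour less. -/
lemma IsCritical.colorable_coe (hG : IsCritical G (m + 1)) {H : G.Subgraph} (hH : H ≠ ⊤) :
    H.coe.Colorable m := by
  have h := hG.2 H hH
  rw [Nat.cast_add, Nat.cast_one] at h
  exact chromaticNumber_le_iff_colorable.1 (Order.le_of_lt_add_one h)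

/-- Deleting an edge of a critical graph allows a colouring making only this edge monochromatic. -/
lemma IsCritical.exists_isColoringExcept (hG : IsCritical G (m + 1)) {x y : V} (hxy : G.Adj x y) :
    ∃ φ : V → Fin m, IsColoringExcept G x y φ := by
  have hne : (⊤ : G.Subgraph).deleteEdges {s(x, y)} ≠ ⊤ := by
    intro h
    have h1 : ((⊤ : G.Subgraph).deleteEdges {s(x, y)}).Adj x y := by rw [h]; exact hxy
    simp at h1
  obtain ⟨C⟩ := hG.colorable_coe hne
  let φ : V → Fin m := fun v => C ⟨v, trivial⟩
  have hφ : ∀ u v, G.Adj u v → φ u = φ v → s(u, v) = s(x, y) := by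
    intro u v huv he
    by_contra hn
    refine C.valid (v := ⟨u, trivial⟩) (w := ⟨v, trivial⟩) ?_ he
    rw [Subgraph.coe_adj, Subgraph.deleteEdges_adj]
    exact ⟨huv, hn⟩
  refine ⟨φ, ?_, hφ⟩
  by_contra hn
  have hcol : G.Colorable m := by
    refine ⟨Coloring.mk φ ?_⟩
    intro u v huv he
    rcases Sym2.eq_iff.1 (hφ u v huv he) with ⟨rfl, rfl⟩ | ⟨rfl, rfl⟩
    · exact hn he
    · exact hn he.symm
  have h := chromaticNumber_le_iff_colorable.2 hcol
  rw [hG.1] at h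
  have h' : m + 1 ≤ m := by exact_mod_cast h
  omega

/-- A `k`-critical graph on more than `k` vertices contains no `K_k`. -/
lemma IsCritical.cliqueFree_s1 [Fintype V] (hG : IsCritical G (m + 1))
    (hcard : m + 1 < Fintype.card V) : G.CliqueFree (m + 1) := by
  intro s hs
  have hne : (⊤ : G.Subgraph).induce (s : Set V) ≠ ⊤ := by
    intro h
    have h1 : (s : Set V) = Set.univ := congrArg Subgraph.verts h
    rw [Finset.coe_eq_univ] at h1
    have h2 := hs.card_eq
    rw [h1, Finset.card_univ] at h2
    omega
  obtain ⟨C⟩ := hG.colorable_coe hne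
  have hinj : Function.Injective (fun v : s => C ⟨v.1, v.2⟩) := by
    intro u v he
    by_contra hn
    refine C.valid (v := ⟨u.1, u.2⟩) (w := ⟨v.1, v.2⟩) ?_ he
    rw [Subgraph.coe_adj, Subgraph.induce_adj]
    exact ⟨u.2, v.2, hs.isClique u.2 v.2 fun h => hn (Subtype.ext h)⟩
  have h := Fintype.card_le_of_injective _ hinj
  rw [Fintype.card_coe, hs.card_eq, Fintype.card_fin] at h
  omega

end Critical

section Coloring

variable {V : Type*} [DecidableEq V] {G : SimpleGraph V} {m : ℕ}

/-- If `φ` uses `m` colours and `Q` is an `m`-clique not containing the exceptional edge, then `Q`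
meets each colour class exactly once. -/
lemma IsColoringExcept.card_filter_eq_one {x y : V} {φ : V → Fin m} (hφ : IsColoringExcept G x y φ)
    {Q : Finset V} (hQ : G.IsNClique m Q) (hxy : ¬ (x ∈ Q ∧ y ∈ Q)) (c : Fin m) :
    (Q.filter (φ · = c)).card = 1 := by
  have hinj : Set.InjOn φ Q := by
    intro u hu v hv he
    by_contra hn
    rcases Sym2.eq_iff.1 (hφ.2 u v (hQ.isClique hu hv hn) he) with ⟨rfl, rfl⟩ | ⟨rfl, rfl⟩
    · exact hxy ⟨hu, hv⟩
    · exact hxy ⟨hv, hu⟩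
  have himg : Q.image φ = Finset.univ := by
    rw [← Finset.card_eq_iff_eq_univ, Finset.card_image_of_injOn hinj, hQ.card_eq, Fintype.card_fin]
  obtain ⟨v, hv, rfl⟩ := Finset.mem_image.1 (himg ▸ Finset.mem_univ c : c ∈ Q.image φ)
  rw [Finset.card_eq_one]
  refine ⟨v, ?_⟩
  ext w
  simp only [Finset.mem_filter, Finset.mem_singleton]
  exact ⟨fun h => hinj h.1 hv h.2, fun h => by subst h; exact ⟨hv, rfl⟩⟩

/-- The only vertices of a clique through `x` with the colour of the exceptional edge `xy`
are `x` and `y`. -/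
lemma IsColoringExcept.eq_or_eq {x y v : V} {φ : V → Fin m} (hφ : IsColoringExcept G x y φ)
    {Q : Finset V} (hQ : G.IsClique Q) (hx : x ∈ Q) (hv : v ∈ Q) (he : φ v = φ x) :
    v = x ∨ v = y := by
  by_contra! hn
  rcases Sym2.eq_iff.1 (hφ.2 v x (hQ hv hx hn.1) he) with ⟨h, _⟩ | ⟨h, _⟩
  · exact hn.1 h
  · exact hn.2 h

/-- If `Q` is a clique containing the exceptional edge, then `Q` meets the colour class of that
edge exactly twice. -/
lemma IsColoringExcept.card_filter_eq_two {x y : V} {φ : V → Fin m} (hφ : IsColoringExcept G x y φ)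
    {Q : Finset V} (hQ : G.IsClique Q) (hx : x ∈ Q) (hy : y ∈ Q) (hne : x ≠ y) :
    (Q.filter (φ · = φ x)).card = 2 := by
  rw [Finset.card_eq_two]
  refine ⟨x, y, hne, ?_⟩
  ext w
  simp only [Finset.mem_filter, Finset.mem_insert, Finset.mem_singleton]
  refine ⟨fun h => hφ.eq_or_eq hQ hx h.1 h.2, ?_⟩
  rintro (rfl | rfl)
  · exact ⟨hx, rfl⟩
  · exact ⟨hy, hφ.1.symm⟩

end Coloring

section CliqueSum

variable {V : Type*} [Fintype V] [DecidableEq V] {G : SimpleGraph V} [DecidableRel G.Adj] {m : ℕ}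

variable (G m) in
/-- The total weight of the `m`-cliques of `G` containing `K`. -/
def cliqueSum (a : Finset V → ℚ) (K : Finset V) : ℚ :=
  ∑ Q ∈ G.cliqueFinset m with K ⊆ Q, a Q

lemma sum_cliqueSum_insert (a : Finset V → ℚ) (K A : Finset V) :
    ∑ v ∈ A, cliqueSum G m a (insert v K) =
      ∑ Q ∈ G.cliqueFinset m with K ⊆ Q, a Q * ((Q.filter (· ∈ A)).card : ℚ) := by
  unfold cliqueSum
  simp_rw [Finset.insert_subset_iff, and_comm (b := K ⊆ _), ← Finset.filter_filter]
  simp_rw [Finset.sum_filter (fun Q => _ ∈ Q)]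
  rw [Finset.sum_comm]
  refine Finset.sum_congr rfl fun Q _ => ?_
  rw [← Finset.sum_filter, Finset.sum_const, nsmul_eq_mul, mul_comm]
  congr 3
  ext v
  simp [and_comm]

lemma cliqueSum_empty (a : Finset V → ℚ) :
    cliqueSum G m a ∅ = ∑ Q ∈ G.cliqueFinset m, a Q := by
  simp [cliqueSum]

lemma sum_cliqueSum_singleton (a : Finset V → ℚ) :
    ∑ v, cliqueSum G m a {v} = m * cliqueSum G m a ∅ := by
  have h := sum_cliqueSum_insert (G := G) (m := m) a ∅ Finset.univ
  simp only [insert_empty_eq] at h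
  rw [h, cliqueSum, Finset.mul_sum]
  refine Finset.sum_congr rfl fun Q hQ => ?_
  have hc := (mem_cliqueFinset_iff.1 (Finset.mem_filter.1 hQ).1).card_eq
  simp [hc, mul_comm]

lemma cliqueSum_eq_zero_of_not_isClique (a : Finset V → ℚ) {K : Finset V}
    (hK : ¬ G.IsClique (K : Set V)) : cliqueSum G m a K = 0 := by
  refine Finset.sum_eq_zero fun Q hQ => ?_
  rw [Finset.mem_filter, mem_cliqueFinset_iff] at hQ
  exact absurd (hQ.1.isClique.subset (Finset.coe_subset.2 hQ.2)) hK

/-- Summing over the colour class of the exceptional edge. -/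
lemma IsColoringExcept.sum_cliqueSum {x y : V} {φ : V → Fin m} (hφ : IsColoringExcept G x y φ)
    (hne : x ≠ y) (a : Finset V → ℚ) (K : Finset V) :
    ∑ v with φ v = φ x, cliqueSum G m a (insert v K) =
      cliqueSum G m a K + cliqueSum G m a (insert x (insert y K)) := by
  have h2 : cliqueSum G m a (insert x (insert y K)) =
      ∑ Q ∈ G.cliqueFinset m with K ⊆ Q, if x ∈ Q ∧ y ∈ Q then a Q else 0 := by
    rw [cliqueSum, ← Finset.sum_filter, Finset.filter_filter]
    refine Finset.sum_congr (Finset.filter_congr fun Q _ => ?_) fun _ _ => rfl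
    simp only [Finset.insert_subset_iff]
    tauto
  rw [sum_cliqueSum_insert, h2, cliqueSum, ← Finset.sum_add_distrib]
  refine Finset.sum_congr rfl fun Q hQ => ?_
  rw [Finset.mem_filter, mem_cliqueFinset_iff] at hQ
  simp only [Finset.mem_filter, Finset.mem_univ, true_and]
  split_ifs with h
  · rw [hφ.card_filter_eq_two hQ.1.isClique h.1 h.2 hne]
    push_cast
    ring
  · rw [hφ.card_filter_eq_one hQ.1 h]
    simp

/-- If every edge of `G` is the only monochromatic edge of some `m`-colouring, then the
characteristic vectors of the `m`-cliques are linearly independent. -/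
lemma eq_zero_of_cliqueSum_singleton_eq_zero (hm : m ≠ 0)
    (hG : ∀ x y, G.Adj x y → ∃ φ : V → Fin m, IsColoringExcept G x y φ) {a : Finset V → ℚ}
    (ha : ∀ v, cliqueSum G m a {v} = 0) {Q : Finset V} (hQ : G.IsNClique m Q) : a Q = 0 := by
  have key : ∀ (c : ℕ) (K : Finset V), K.card = c → cliqueSum G m a K = 0 := by
    intro c
    induction c using Nat.strong_induction_on with
    | _ c ih =>
      intro K hK
      obtain rfl | ⟨x, hx⟩ := K.eq_empty_or_nonempty
      · have h := sum_cliqueSum_singleton (G := G) (m := m) a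
        simp only [ha, Finset.sum_const_zero] at h
        have hm' : (m : ℚ) ≠ 0 := by exact_mod_cast hm
        exact (mul_eq_zero.1 h.symm).resolve_left hm'
      obtain h1 | ⟨y, hy⟩ := (K.erase x).eq_empty_or_nonempty
      · rw [← Finset.insert_erase hx, h1]
        exact ha x
      have hyx : y ≠ x := (Finset.mem_erase.1 hy).1
      by_cases hadj : G.Adj x y
      · obtain ⟨φ, hφ⟩ := hG x y hadj
        have h := hφ.sum_cliqueSum hadj.ne a ((K.erase x).erase y)
        rw [Finset.insert_erase hy, Finset.insert_erase hx] at h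
        have hc1 := Finset.card_erase_add_one hx
        have hc2 := Finset.card_erase_add_one hy
        rw [ih _ (by omega) _ rfl, zero_add] at h
        rw [← h]
        refine Finset.sum_eq_zero fun v _ => ih _ ?_ _ rfl
        have := Finset.card_insert_le v ((K.erase x).erase y)
        omega
      · exact cliqueSum_eq_zero_of_not_isClique a fun h =>
          hadj (h hx (Finset.mem_of_mem_erase hy) hyx.symm)
  rw [← key _ Q rfl, cliqueSum, Finset.sum_eq_single_of_mem Q]
  · simp [hQ]
  · intro R hR hne
    rw [Finset.mem_filter, mem_cliqueFinset_iff] at hR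
    exact absurd (Finset.eq_of_subset_of_card_le hR.2 (by rw [hR.1.card_eq, hQ.card_eq])).symm hne

/-- A weighting of total weight zero whose vertex sums are supported on an `m`-clique `Q₀` has
vertex sum zero at every vertex of `Q₀` whose degree differs from `m`. -/
lemma cliqueSum_singleton_eq_zero_of_degree_ne
    (hG : ∀ x y, G.Adj x y → ∃ φ : V → Fin m, IsColoringExcept G x y φ) {a : Finset V → ℚ}
    {Q₀ : Finset V} (hQ₀ : G.IsNClique m Q₀) (h0 : cliqueSum G m a ∅ = 0)
    (ha : ∀ v ∉ Q₀, cliqueSum G m a {v} = 0) {z : V} (hz : z ∈ Q₀) (hd : G.degree z ≠ m) :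
    cliqueSum G m a {z} = 0 := by
  have hedge : ∀ v ∈ G.neighborFinset z, cliqueSum G m a (insert v {z}) =
      cliqueSum G m a {z} + cliqueSum G m a {v} := by
    intro v hv
    have hzv : G.Adj z v := (G.mem_neighborFinset z v).1 hv
    obtain ⟨φ, hφ⟩ := hG z v hzv
    have h := hφ.sum_cliqueSum hzv.ne a ∅
    rw [h0, zero_add] at h
    simp only [insert_empty_eq] at h
    rw [Finset.pair_comm, ← h, ← Finset.sum_pair (f := fun w => cliqueSum G m a {w}) hzv.ne]
    symm
    refine Finset.sum_subset ?_ ?_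
    · intro w hw
      simp only [Finset.mem_insert, Finset.mem_singleton] at hw
      rcases hw with rfl | rfl
      · simp
      · simp [hφ.1]
    · intro w hw hwn
      refine ha w fun hwQ => hwn ?_
      simpa using hφ.eq_or_eq hQ₀.isClique hz hwQ (by simpa using hw)
  have hsum := sum_cliqueSum_insert (G := G) (m := m) a {z} (G.neighborFinset z)
  have hright : ∑ Q ∈ G.cliqueFinset m with {z} ⊆ Q,
      a Q * ((Q.filter (· ∈ G.neighborFinset z)).card : ℚ) = (m - 1) * cliqueSum G m a {z} := by
    rw [cliqueSum, Finset.mul_sum]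
    refine Finset.sum_congr rfl fun Q hQ => ?_
    rw [Finset.mem_filter, mem_cliqueFinset_iff, Finset.singleton_subset_iff] at hQ
    have he : Q.filter (· ∈ G.neighborFinset z) = Q.erase z := by
      ext w
      simp only [Finset.mem_filter, mem_neighborFinset, Finset.mem_erase]
      exact ⟨fun h => ⟨h.2.ne', h.1⟩, fun h => ⟨h.2, hQ.1.isClique hQ.2 h.2 h.1.symm⟩⟩
    have hc := Finset.card_erase_add_one hQ.2
    rw [hQ.1.card_eq] at hc
    rw [he, ← hc]
    push_cast
    ring
  have htotal : ∑ v ∈ G.neighborFinset z, cliqueSum G m a {v} = - cliqueSum G m a {z} := by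
    have h := sum_cliqueSum_singleton (G := G) (m := m) a
    rw [h0, mul_zero, ← Finset.add_sum_erase _ _ (Finset.mem_univ z)] at h
    have h' : ∑ v ∈ G.neighborFinset z, cliqueSum G m a {v} =
        ∑ v ∈ Finset.univ.erase z, cliqueSum G m a {v} := by
      refine Finset.sum_subset ?_ ?_
      · intro v hv
        simpa using ((G.mem_neighborFinset z v).1 hv).ne'
      · intro v hv hvn
        refine ha v fun hvQ => hvn ?_
        rw [mem_neighborFinset]
        exact hQ₀.isClique hz hvQ (by simpa [eq_comm] using hv)
    rw [h']
    linarith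
  rw [hright, Finset.sum_congr rfl hedge, Finset.sum_add_distrib, htotal, Finset.sum_const,
    card_neighborFinset_eq_degree, nsmul_eq_mul] at hsum
  have hfac : ((G.degree z : ℚ) - m) * cliqueSum G m a {z} = 0 := by linarith
  refine (mul_eq_zero.1 hfac).resolve_left fun h => hd ?_
  exact_mod_cast sub_eq_zero.1 h

/-- A weighting of total weight zero that vanishes on the cliques containing an edge `xy` not
contained in the `m`-clique `Q₀`, and whose vertex sums are supported on `Q₀`, has vanishing
vertex sums. -/
lemma cliqueSum_singleton_eq_zero_of_edge {x y : V} {φ : V → Fin m}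
    (hφ : IsColoringExcept G x y φ) {a : Finset V → ℚ} {Q₀ : Finset V} (hQ₀ : G.IsNClique m Q₀)
    (hxy : ¬ (x ∈ Q₀ ∧ y ∈ Q₀)) (hsupp : ∀ Q, x ∈ Q → y ∈ Q → a Q = 0)
    (h0 : cliqueSum G m a ∅ = 0) (ha : ∀ v ∉ Q₀, cliqueSum G m a {v} = 0) {z : V} (hz : z ∈ Q₀) :
    cliqueSum G m a {z} = 0 := by
  have h := sum_cliqueSum_insert (G := G) (m := m) a ∅ (Finset.univ.filter (φ · = φ z))
  have hright : ∑ Q ∈ G.cliqueFinset m with ∅ ⊆ Q,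
      a Q * ((Q.filter (· ∈ Finset.univ.filter (φ · = φ z))).card : ℚ) = cliqueSum G m a ∅ := by
    refine Finset.sum_congr rfl fun Q hQ => ?_
    rw [Finset.mem_filter, mem_cliqueFinset_iff] at hQ
    by_cases hQxy : x ∈ Q ∧ y ∈ Q
    · rw [hsupp Q hQxy.1 hQxy.2, zero_mul]
    · simp only [Finset.mem_filter, Finset.mem_univ, true_and]
      rw [hφ.card_filter_eq_one hQ.1 hQxy, Nat.cast_one, mul_one]
  rw [hright, h0, Finset.sum_eq_single_of_mem z (by simp)] at h
  · simpa using h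
  · intro v hv hvz
    refine ha v fun hvQ => hvz ?_
    obtain ⟨w, hw⟩ := Finset.card_eq_one.1 (hφ.card_filter_eq_one hQ₀ hxy (φ z))
    have h1 : v ∈ Q₀.filter (φ · = φ z) := by simpa [hvQ] using hv
    have h2 : z ∈ Q₀.filter (φ · = φ z) := by simp [hz]
    rw [hw, Finset.mem_singleton] at h1 h2
    rw [h1, h2]

/-- A family of `m`-cliques has at most `|V| - m + 1` members if no nontrivial weighting of it has
total weight zero and vertex sums supported on the `m`-clique `Q₀`. -/
lemma card_add_le_of_forall_eq_zero {F : Finset (Finset V)} (hF : F ⊆ G.cliqueFinset m)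
    {Q₀ : Finset V} (hQ₀ : G.IsNClique m Q₀)
    (h : ∀ a : Finset V → ℚ, (∀ Q ∉ F, a Q = 0) → cliqueSum G m a ∅ = 0 →
      (∀ v ∉ Q₀, cliqueSum G m a {v} = 0) → ∀ Q ∈ F, a Q = 0) :
    F.card + m ≤ Fintype.card V + 1 := by
  let f : F → Option {v // v ∉ Q₀} → ℚ := fun Q o => o.elim 1 fun v => if v.1 ∈ Q.1 then 1 else 0
  have hf : LinearIndependent ℚ f := by
    rw [Fintype.linearIndependent_iff]
    intro g hg Q
    let a : Finset V → ℚ := fun R => if hR : R ∈ F then g ⟨R, hR⟩ else 0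
    have haF : ∀ R : F, a R = g R := fun R => by simp [a]
    have hsum : ∀ w : Finset V → ℚ,
        ∑ R ∈ G.cliqueFinset m, a R * w R = ∑ R : F, g R * w R := by
      intro w
      rw [← Finset.sum_subset hF fun R _ hR => by simp [a, hR], ← Finset.sum_coe_sort F]
      exact Finset.sum_congr rfl fun R _ => by rw [haF]
    have happ : ∀ o, ∑ R : F, g R * f R o = 0 := fun o => by
      simpa [Finset.sum_apply] using congrFun hg o
    rw [← haF]
    refine h a (fun R hR => by simp [a, hR]) ?_ ?_ Q Q.2
    · have h1 := hsum fun _ => 1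
      rw [cliqueSum_empty]
      simp only [mul_one] at h1
      rw [h1]
      simpa [f] using happ none
    · intro v hv
      have h1 := hsum fun R => if v ∈ R then 1 else 0
      simp only [mul_ite, mul_one, mul_zero] at h1
      rw [cliqueSum]
      simp only [Finset.singleton_subset_iff]
      rw [Finset.sum_filter, h1]
      simpa [f] using happ (some ⟨v, hv⟩)
  have hc := hf.fintype_card_le_finrank
  rw [Module.finrank_fintype_fun_eq_card, Fintype.card_option, Fintype.card_coe] at hc
  have hcompl : Fintype.card {v // v ∉ Q₀} = Fintype.card V - m := by
    rw [Fintype.card_subtype_compl, Fintype.card_coe, hQ₀.card_eq]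
  have hle : m ≤ Fintype.card V := hQ₀.card_eq ▸ Q₀.card_le_univ
  omega

/-- If a vertex `z` of an `m`-clique `Q₀` has degree `m` and there is no `(m+1)`-clique, then the
edge from `z` leaving `Q₀` lies in at most one `m`-clique. -/
lemma exists_adj_card_le_one_of_degree_eq (hfree : G.CliqueFree (m + 1)) {Q₀ : Finset V}
    (hQ₀ : G.IsNClique m Q₀) {z : V} (hz : z ∈ Q₀) (hd : G.degree z = m) :
    ∃ v ∉ Q₀, G.Adj z v ∧ ((G.cliqueFinset m).filter fun Q => z ∈ Q ∧ v ∈ Q).card ≤ 1 := by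
  have hcardQ := Finset.card_erase_add_one hz
  rw [hQ₀.card_eq] at hcardQ
  obtain ⟨v, hv, hvQ⟩ : ∃ v ∈ G.neighborFinset z, v ∉ Q₀.erase z :=
    Finset.exists_mem_notMem_of_card_lt_card (by rw [card_neighborFinset_eq_degree]; omega)
  have hzv : G.Adj z v := (G.mem_neighborFinset z v).1 hv
  have hvQ₀ : v ∉ Q₀ := fun h => hvQ (Finset.mem_erase.2 ⟨hzv.ne', h⟩)
  refine ⟨v, hvQ₀, hzv, ?_⟩
  obtain ⟨w, hw, hvw⟩ : ∃ w ∈ Q₀, ¬ G.Adj v w := by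
    by_contra! hall
    exact hfree _ (hQ₀.insert hall)
  have hwz : w ≠ z := fun h => hvw (h ▸ hzv.symm)
  have huniq : ∀ Q ∈ (G.cliqueFinset m).filter fun Q => z ∈ Q ∧ v ∈ Q,
      Q = insert z ((G.neighborFinset z).erase w) := by
    intro Q hQ
    rw [Finset.mem_filter, mem_cliqueFinset_iff] at hQ
    obtain ⟨hQc, hzQ, hvQ'⟩ := hQ
    refine Finset.eq_of_subset_of_card_le ?_ ?_
    · intro u hu
      rcases eq_or_ne u z with rfl | huz
      · exact Finset.mem_insert_self _ _
      refine Finset.mem_insert_of_mem (Finset.mem_erase.2 ⟨?_, ?_⟩)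
      · rintro rfl
        exact hvw (hQc.isClique hvQ' hu fun h => hvQ₀ (h ▸ hw))
      · exact (G.mem_neighborFinset z u).2 (hQc.isClique hzQ hu huz.symm)
    · have hwN : w ∈ G.neighborFinset z :=
        (G.mem_neighborFinset z w).2 (hQ₀.isClique hz hw hwz.symm)
      have h1 := Finset.card_erase_add_one hwN
      have h2 := Finset.card_insert_le z ((G.neighborFinset z).erase w)
      rw [card_neighborFinset_eq_degree] at h1
      rw [hQc.card_eq]
      omega
  exact Finset.card_le_one.2 fun Q hQ R hR => (huniq Q hQ).trans (huniq R hR).symm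

end CliqueSum

/-- A `k`-critical graph on `n > k` vertices has at most `n - k + 3` cliques of size `k - 1`
(here `k = m + 1`), provided it has at least one. -/
theorem IsCritical.cliqueCount_add_le {V : Type*} [Fintype V] {G : SimpleGraph V} {m : ℕ}
    (hm : m ≠ 0) (hG : IsCritical G (m + 1)) (hcard : m + 1 < Fintype.card V)
    (hpos : cliqueCount G m ≠ 0) : cliqueCount G m + m ≤ Fintype.card V + 2 := by
  classical
  have hcount : cliqueCount G m = (G.cliqueFinset m).card := by
    rw [cliqueCount, ← Set.ncard_coe_finset, coe_cliqueFinset]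
    rfl
  rw [hcount] at hpos ⊢
  obtain ⟨Q₀, hQ₀⟩ := Finset.card_ne_zero.1 hpos
  rw [mem_cliqueFinset_iff] at hQ₀
  have hcol : ∀ x y, G.Adj x y → ∃ φ : V → Fin m, IsColoringExcept G x y φ :=
    fun x y hxy => hG.exists_isColoringExcept hxy
  have hzero : ∀ a : Finset V → ℚ, (∀ v ∉ Q₀, cliqueSum G m a {v} = 0) →
      (∀ v ∈ Q₀, cliqueSum G m a {v} = 0) → ∀ Q ∈ G.cliqueFinset m, a Q = 0 :=
    fun a h1 h2 Q hQ => eq_zero_of_cliqueSum_singleton_eq_zero hm hcol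
      (fun v => if hv : v ∈ Q₀ then h2 v hv else h1 v hv) (mem_cliqueFinset_iff.1 hQ)
  by_cases hdeg : ∃ z ∈ Q₀, G.degree z = m
  · obtain ⟨z, hz, hd⟩ := hdeg
    obtain ⟨v, hv, hzv, hle⟩ :=
      exists_adj_card_le_one_of_degree_eq (hG.cliqueFree_s1 hcard) hQ₀ hz hd
    obtain ⟨φ, hφ⟩ := hcol z v hzv
    have h := card_add_le_of_forall_eq_zero
      (F := (G.cliqueFinset m).filter fun Q => ¬ (z ∈ Q ∧ v ∈ Q)) (Finset.filter_subset _ _) hQ₀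
      fun a hF h0 ha Q hQ => hzero a ha
        (fun u hu => cliqueSum_singleton_eq_zero_of_edge hφ hQ₀ (fun h => hv h.2)
          (fun R hzR hvR => hF R fun hR => (Finset.mem_filter.1 hR).2 ⟨hzR, hvR⟩) h0 ha hu)
        Q (Finset.mem_filter.1 hQ).1
    have hsplit := Finset.card_filter_add_card_filter_not (s := G.cliqueFinset m)
      fun Q => z ∈ Q ∧ v ∈ Q
    omega
  · push Not at hdeg
    have h := card_add_le_of_forall_eq_zero (F := G.cliqueFinset m) subset_rfl hQ₀
      fun a _ h0 ha => hzero a ha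
        fun z hz => cliqueSum_singleton_eq_zero_of_degree_ne hcol hQ₀ h0 ha hz (hdeg z hz)
    omega

/-- Kézdy–Snevily: for `n > k ≥ 4`, every `k`-critical graph on `n` vertices has
fewer than `n - 3k/5 + 2` copies of `K_{k-1}`. -/
theorem kezdy_snevily {V : Type*} [Fintype V] {n k : ℕ} (hk : 4 ≤ k) (hn : k < n)
    (hcard : Fintype.card V = n) (G : SimpleGraph V) (hG : IsCritical G k) :
    (cliqueCount G (k - 1) : ℝ) < n - 3 * k / 5 + 2 := by
  obtain ⟨m, rfl⟩ : ∃ m, k = m + 1 := ⟨k - 1, by omega⟩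
  subst hcard
  have hk' : (4 : ℝ) ≤ m + 1 := by exact_mod_cast hk
  have hn' : (m : ℝ) + 1 < Fintype.card V := by exact_mod_cast hn
  rw [Nat.add_sub_cancel]
  push_cast
  by_cases hpos : cliqueCount G m = 0
  · rw [hpos, Nat.cast_zero]
    linarith
  · have h : (cliqueCount G m : ℝ) + m ≤ Fintype.card V + 2 := by
      exact_mod_cast hG.cliqueCount_add_le (by omega) hn hpos
    linarith
end

section
/- Every 4-critical graph G on n vertices contains at most n triangles, i.e., t_3(G) ≤ n. -/
open SimpleGraph

theorem IsCritical.exists_three_coloring {V : Type*} {G : SimpleGraph V} (hG : IsCritical G 4)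
    (H : G.Subgraph) (hH : H ≠ ⊤) : ∃ c : V → Fin 3, ∀ u v, H.Adj u v → c u ≠ c v := by
  classical
  have hlt := hG.2 H hH
  have hle : H.coe.chromaticNumber ≤ (3 : ℕ) := by
    rw [← ENat.lt_add_one_iff (by simp)]
    simpa [show (3 + 1 : ℕ∞) = 4 by norm_num] using hlt
  obtain ⟨C⟩ := chromaticNumber_le_iff_colorable.1 hle
  refine ⟨fun v => if hv : v ∈ H.verts then C ⟨v, hv⟩ else 0, fun u v huv => ?_⟩
  have hu := H.edge_vert huv
  have hv := H.edge_vert huv.symm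
  simp only [hu, hv, dif_pos]
  exact C.valid (by simpa using huv)

theorem IsCritical.not_colorable_three {V : Type*} {G : SimpleGraph V} (hG : IsCritical G 4) :
    ¬ G.Colorable 3 := by
  intro h
  have := chromaticNumber_le_iff_colorable.2 h
  rw [hG.1] at this
  exact absurd (ENat.natCast_le_natCast.1 this) (by norm_num)

theorem IsCritical.exists_coloring_off_vertex {V : Type*} {G : SimpleGraph V}
    (hG : IsCritical G 4) (w : V) :
    ∃ c : V → Fin 3, ∀ u v, u ≠ w → v ≠ w → G.Adj u v → c u ≠ c v := by
  obtain ⟨c, hc⟩ := hG.exists_three_coloring ((⊤ : G.Subgraph).deleteVerts {w}) (by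
    intro h
    have hw : w ∈ ((⊤ : G.Subgraph).deleteVerts {w}).verts := by rw [h]; trivial
    simp at hw)
  exact ⟨c, fun u v hu hv huv => hc u v (by simp [hu, hv, huv])⟩

theorem IsCritical.exists_coloring_off_edge {V : Type*} {G : SimpleGraph V}
    (hG : IsCritical G 4) {x y : V} (hxy : G.Adj x y) :
    ∃ c : V → Fin 3, c x = c y ∧ ∀ u v, G.Adj u v → s(u, v) ≠ s(x, y) → c u ≠ c v := by
  obtain ⟨c, hc⟩ := hG.exists_three_coloring ((⊤ : G.Subgraph).deleteEdges {s(x, y)}) (by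
    intro h
    have hadj : ((⊤ : G.Subgraph).deleteEdges {s(x, y)}).Adj x y := by rw [h]; exact hxy
    simp at hadj)
  have hc' : ∀ u v, G.Adj u v → s(u, v) ≠ s(x, y) → c u ≠ c v := fun u v huv hne =>
    hc u v (by rw [Subgraph.deleteEdges_adj]; exact ⟨huv, hne⟩)
  refine ⟨c, ?_, hc'⟩
  by_contra hne
  refine hG.not_colorable_three ⟨Coloring.mk c fun {u v} huv => ?_⟩
  by_cases h : s(u, v) = s(x, y)
  · rcases Sym2.eq_iff.1 h with ⟨rfl, rfl⟩ | ⟨rfl, rfl⟩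
    exacts [hne, Ne.symm hne]
  · exact hc' u v huv h

theorem Fin.eq_iff_ne_of_ne_three : ∀ a p q r : Fin 3, p ≠ a → q ≠ a → r ≠ a → p ≠ q →
    (p = r ↔ q ≠ r) := by
  omega

theorem IsCritical.sum_weight_edge_eq_zero {V : Type*} [DecidableEq V]
    {G : SimpleGraph V} (hG : IsCritical G 4) {𝒯 : Finset (Finset V)}
    (h𝒯 : ∀ T ∈ 𝒯, G.IsNClique 3 T) {g : Finset V → ZMod 2}
    (hg : ∀ f : V → ZMod 2, ∑ T ∈ 𝒯, g T * ∑ v ∈ T, f v = 0) {x y : V} (hxy : G.Adj x y) :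
    ∑ T ∈ 𝒯, g T * (if x ∈ T ∧ y ∈ T then 1 else 0) = 0 := by
  obtain ⟨c, hcxy, hc⟩ := hG.exists_coloring_off_edge hxy
  refine Eq.trans ?_ (hg fun v => if c v = c x then 0 else 1)
  refine Finset.sum_congr rfl fun T hT => ?_
  congr 1
  have hTc := h𝒯 T hT
  split_ifs with h
  · obtain ⟨z, hz⟩ : ∃ z, z ∈ T \ {x, y} := by
      have : 0 < (T \ {x, y}).card := by
        have h1 := Finset.le_card_sdiff {x, y} T
        have h2 : ({x, y} : Finset V).card ≤ 2 := Finset.card_le_two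
        have := hTc.card_eq
        omega
      exact Finset.card_pos.1 this
    simp only [Finset.mem_sdiff, Finset.mem_insert, Finset.mem_singleton, not_or] at hz
    obtain ⟨hzT, hzx, hzy⟩ := hz
    have hxz : G.Adj x z := hTc.isClique h.1 hzT (Ne.symm hzx)
    have hTeq : T = {x, y, z} := by
      refine (Finset.eq_of_subset_of_card_le ?_ ?_).symm
      · intro v; simp only [Finset.mem_insert, Finset.mem_singleton]
        rintro (rfl | rfl | rfl)
        exacts [h.1, h.2, hzT]
      · rw [hTc.card_eq, Finset.card_eq_three.2 ⟨x, y, z, hxy.ne, Ne.symm hzx, Ne.symm hzy, rfl⟩]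
    have hcz : c z ≠ c x := hc z x hxz.symm (by simp [hzx, hzy])
    rw [hTeq, Finset.sum_insert (by simp [hxy.ne, Ne.symm hzx]),
      Finset.sum_insert (by simp [Ne.symm hzy]), Finset.sum_singleton]
    simp [hcxy.symm, hcz]
  · obtain ⟨u, v, w, huv, huw, hvw, rfl⟩ := is3Clique_iff.1 hTc
    have key : ∀ p q, p ∈ ({u, v, w} : Finset V) → q ∈ ({u, v, w} : Finset V) → G.Adj p q →
        c p ≠ c q := fun p q hp hq hpq => hc p q hpq (by
      intro he
      rcases Sym2.eq_iff.1 he with ⟨rfl, rfl⟩ | ⟨rfl, rfl⟩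
      exacts [h ⟨hp, hq⟩, h ⟨hq, hp⟩])
    have h1 := key u v (by simp) (by simp) huv
    have h2 := key u w (by simp) (by simp) huw
    have h3 := key v w (by simp) (by simp) hvw
    rw [Finset.sum_insert (by simp [huv.ne, huw.ne]), Finset.sum_insert (by simp [hvw.ne]),
      Finset.sum_singleton]
    generalize c u = p at *
    generalize c v = q at *
    generalize c w = r at *
    generalize c x = a at *
    clear * - h1 h2 h3
    revert p q r a
    decide

theorem IsCritical.card_le_four_of_clique {V : Type*} [Fintype V] {G : SimpleGraph V}
    (hG : IsCritical G 4) {K : Finset V} (hK : G.IsNClique 4 K) : Fintype.card V ≤ 4 := by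
  rw [← hK.card_eq, ← Finset.card_univ]
  refine Finset.card_le_card fun w _ => ?_
  by_contra hw
  obtain ⟨c, hc⟩ := hG.exists_coloring_off_vertex w
  have hinj : Set.InjOn c K := fun u hu v hv huv => by
    by_contra hne
    exact hc u v (by rintro rfl; exact hw hu) (by rintro rfl; exact hw hv)
      (hK.isClique hu hv hne) huv
  have := Finset.card_le_card_of_injOn c (t := Finset.univ) (fun _ _ => Finset.mem_univ _) hinj
  rw [hK.card_eq] at this
  simp at this

theorem IsCritical.weight_eq_zero {V : Type*} [Fintype V]
    {G : SimpleGraph V} (hG : IsCritical G 4) (hV : 4 < Fintype.card V)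
    {𝒯 : Finset (Finset V)} (h𝒯 : ∀ T ∈ 𝒯, G.IsNClique 3 T) {g : Finset V → ZMod 2}
    (hg : ∀ f : V → ZMod 2, ∑ T ∈ 𝒯, g T * ∑ v ∈ T, f v = 0) : ∀ T ∈ 𝒯, g T = 0 := by
  classical
  intro T hT
  by_contra hgT
  have hedge := fun {u v : V} (h : G.Adj u v) => hG.sum_weight_edge_eq_zero h𝒯 hg h
  obtain ⟨x, y, z, hxy, hxz, hyz, rfl⟩ := is3Clique_iff.1 (h𝒯 T hT)
  by_cases huniv : ∀ w, w ≠ z → G.Adj z w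
  · obtain ⟨T', hT', hne, hx, hy⟩ : ∃ T' ∈ 𝒯, T' ≠ {x, y, z} ∧ x ∈ T' ∧ y ∈ T' := by
      by_contra! hno
      have := hedge hxy
      rw [Finset.sum_eq_single_of_mem _ hT] at this
      · simp at this
        exact hgT this
      · intro b hb hb'
        rw [if_neg fun h => hno b hb hb' h.1 h.2, mul_zero]
    have hT'c := h𝒯 T' hT'
    have hz : z ∉ T' := fun hz => hne (Finset.eq_of_subset_of_card_le (by
      intro v; simp only [Finset.mem_insert, Finset.mem_singleton]
      rintro (rfl | rfl | rfl)
      exacts [hx, hy, hz]) (by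
      rw [hT'c.card_eq, (h𝒯 _ hT).card_eq])).symm
    have := hG.card_le_four_of_clique
      (hT'c.insert fun w hw => huniv w (by rintro rfl; exact hz hw))
    omega
  · push Not at huniv
    obtain ⟨w, hwz, hw⟩ := huniv
    obtain ⟨c, hcxy, hc⟩ := hG.exists_coloring_off_edge hxy
    obtain ⟨d, hd⟩ := hG.exists_coloring_off_vertex w
    let f : V → ZMod 2 := fun u => if G.Adj z u ∧ (c u = c x ↔ d u = d x) then 1 else 0
    have hzero : ∑ T ∈ 𝒯, g T * (if z ∈ T then ∑ u ∈ T, f u else 0) = 0 := by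
      calc _ = ∑ T ∈ 𝒯, ∑ u, f u * (g T * (if z ∈ T ∧ u ∈ T then 1 else 0)) := by
            refine Finset.sum_congr rfl fun T _ => ?_
            by_cases hz : z ∈ T
            · simp [hz, Finset.mul_sum, mul_comm]
            · simp [hz]
        _ = ∑ u, f u * ∑ T ∈ 𝒯, g T * (if z ∈ T ∧ u ∈ T then 1 else 0) := by
            rw [Finset.sum_comm]
            simp_rw [Finset.mul_sum]
        _ = 0 := Finset.sum_eq_zero fun u _ => by
            by_cases hu : G.Adj z u
            · rw [hedge hu, mul_zero]
            · simp [f, hu]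
    have hadj : ∀ u, G.Adj z u → u ≠ w := by rintro u hu rfl; exact hw hu
    have hdn : ∀ u, G.Adj z u → d u ≠ d z := fun u hu =>
      hd u z (hadj u hu) (Ne.symm hwz) hu.symm
    have hcn : ∀ u, G.Adj z u → c u ≠ c z := fun u hu =>
      hc u z hu.symm (by simp [hxz.ne', hyz.ne'])
    have hfz : f z = 0 := by simp [f]
    rw [Finset.sum_eq_single_of_mem _ hT] at hzero
    · have hdxy := hd y x (hadj y hyz.symm) (hadj x hxz.symm) hxy.symm
      rw [if_pos (by simp), Finset.sum_insert (by simp [hxy.ne, hxz.ne]),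
        Finset.sum_insert (by simp [hyz.ne]), Finset.sum_singleton, hfz] at hzero
      simp [f, hxz.symm, hcxy.symm, hdxy] at hzero
      exact hgT hzero
    · intro S hS hne
      split_ifs with hzS
      · obtain ⟨u, v, hu, hv, huv, rfl⟩ : ∃ u v, G.Adj z u ∧ G.Adj z v ∧ G.Adj u v ∧
            S = {z, u, v} := by
          obtain ⟨p, q, r, hpq, hpr, hqr, rfl⟩ := is3Clique_iff.1 (h𝒯 S hS)
          simp only [Finset.mem_insert, Finset.mem_singleton] at hzS
          rcases hzS with rfl | rfl | rfl
          · exact ⟨q, r, hpq, hpr, hqr, rfl⟩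
          · exact ⟨p, r, hpq.symm, hqr, hpr, Finset.insert_comm _ _ _⟩
          · exact ⟨p, q, hpr.symm, hqr.symm, hpq, by ext; simp; tauto⟩
        have hs : s(u, v) ≠ s(x, y) := by
          intro h
          apply hne
          rcases Sym2.eq_iff.1 h with ⟨rfl, rfl⟩ | ⟨rfl, rfl⟩ <;> ext <;> simp <;> tauto
        have h1 := Fin.eq_iff_ne_of_ne_three _ _ _ (c x) (hcn u hu) (hcn v hv)
          (hcn x hxz.symm) (hc u v huv hs)
        have h2 := Fin.eq_iff_ne_of_ne_three _ _ _ (d x) (hdn u hu) (hdn v hv)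
          (hdn x hxz.symm) (hd u v (hadj u hu) (hadj v hv) huv)
        have hfuv : f u = f v := by
          simp only [f, hu, hv, true_and, h1, h2, ne_eq, not_iff_not]
        rw [Finset.sum_insert (by simp [hu.ne, hv.ne]), Finset.sum_insert (by simp [huv.ne]),
          Finset.sum_singleton, hfz, hfuv, CharTwo.add_self_eq_zero, add_zero, mul_zero]
      · rw [mul_zero]

/-- Stiebitz: every `4`-critical graph on `n` vertices has at most `n` triangles. -/
theorem stiebitz_triangles {V : Type*} [Fintype V] {n : ℕ}
    (hcard : Fintype.card V = n) (G : SimpleGraph V) (hG : IsCritical G 4) :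
    cliqueCount G 3 ≤ n := by
  classical
  have hcount : cliqueCount G 3 = (G.cliqueFinset 3).card := by
    rw [cliqueCount, ← Set.ncard_coe_finset, coe_cliqueFinset]
    rfl
  rw [hcount, ← hcard]
  rcases le_or_gt (Fintype.card V) 4 with hV | hV
  · refine G.card_cliqueFinset_le.trans ?_
    generalize Fintype.card V = m at hV
    interval_cases m <;> decide
  · have hli : LinearIndependent (ZMod 2)
        fun (T : G.cliqueFinset 3) (v : V) => if v ∈ T.1 then (1 : ZMod 2) else 0 := by
      rw [Fintype.linearIndependent_iff]
      intro g hg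
      let g' : Finset V → ZMod 2 := fun T => if h : T ∈ G.cliqueFinset 3 then g ⟨T, h⟩ else 0
      have hg' : ∀ v, ∑ T ∈ G.cliqueFinset 3, g' T * (if v ∈ T then 1 else 0) = 0 := fun v => by
        rw [← Finset.sum_coe_sort]
        have := congrFun hg v
        simp only [Finset.sum_apply, Pi.smul_apply, smul_eq_mul, Pi.zero_apply] at this
        refine Eq.trans ?_ this
        exact Finset.sum_congr rfl fun T _ => by rw [show g' T = g T from dif_pos T.2]
      have := hG.weight_eq_zero hV (𝒯 := G.cliqueFinset 3) (g := g')
        (fun T => mem_cliqueFinset_iff.1) (fun f => by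
          calc _ = ∑ T ∈ G.cliqueFinset 3, ∑ v, f v * (g' T * (if v ∈ T then 1 else 0)) := by
                refine Finset.sum_congr rfl fun T _ => ?_
                simp [mul_comm, Finset.sum_mul]
            _ = ∑ v, f v * ∑ T ∈ G.cliqueFinset 3, g' T * (if v ∈ T then 1 else 0) := by
                rw [Finset.sum_comm]
                simp_rw [Finset.mul_sum]
            _ = 0 := Finset.sum_eq_zero fun v _ => by rw [hg' v, mul_zero])
      intro T
      exact (show g' T = g T from dif_pos T.2).symm.trans (this T.1 T.2)
    rw [← Fintype.card_coe]
    exact hli.fintype_card_le_finrank.trans_eq (Module.finrank_fintype_fun_eq_card _)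
end

section
/- For every integer k ≥ 4 there exists a constant c_k > 0 such that for infinitely many integers n there is a k-critical graph G on n vertices satisfying t_ℓ(G) ≥ c_k · n^ℓ for every ℓ ∈ {2, 3, ..., k-2}. -/
open SimpleGraph

namespace SimpleGraph

variable {V : Type*}

lemma Colorable.of_deleteEdges_singleton {G : SimpleGraph V} {n : ℕ} {a b : V}
    (h : (G.deleteEdges {s(a, b)}).Colorable n) : G.Colorable (n + 1) := by
  classical
  obtain ⟨C⟩ := h
  have D : G.Coloring (Option (Fin n)) := by
    refine Coloring.mk (fun v => if v = a then none else some (C v)) fun {u v} huv => ?_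
    have hne := huv.ne
    by_cases hu : u = a <;> by_cases hv : v = a <;> simp only [hu, hv, if_true, if_false] <;> simp
    · exact hne (hu.trans hv.symm)
    · refine C.valid ?_
      simp [deleteEdges_adj, huv, hu, hv]
  simpa using D.colorable

lemma not_colorable_two_cycleGraph {n : ℕ} (h : 2 ≤ n) (hn : Odd n) :
    ¬ (cycleGraph n).Colorable 2 := by
  rw [← chromaticNumber_le_iff_colorable, chromaticNumber_cycleGraph_of_odd n h hn]
  decide

/-- A finite graph with chromatic number `k + 1` has a `(k + 1)`-critical subgraph. -/
lemma exists_isCritical_subgraph [Finite V] {G : SimpleGraph V} {k : ℕ}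
    (hG : G.Colorable (k + 1)) (hG' : ¬ G.Colorable k) :
    ∃ H : G.Subgraph, IsCritical H.coe (k + 1) := by
  obtain ⟨H, hH⟩ := exists_minimal_of_wellFoundedLT
    (fun H : G.Subgraph => ¬ H.coe.Colorable k)
    ⟨⊤, fun h => hG' (h.of_hom Subgraph.topIso.symm.toHom)⟩
  refine ⟨H, ?_, fun K hK => ?_⟩
  · rw [Nat.cast_add_one, chromaticNumber_eq_iff_colorable_not_colorable]
    exact ⟨hG.of_hom H.hom, hH.prop⟩
  · have hlt : Subgraph.coeSubgraph K < H := by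
      refine lt_of_le_of_ne (Subgraph.coeSubgraph_le K) fun h => hK ?_
      refine Subgraph.coeSubgraph_injective H (h.trans ?_)
      ext <;> simp
    have hc : (Subgraph.coeSubgraph K).coe.Colorable k := by
      by_contra h
      exact hlt.not_ge (hH.le_of_le h hlt.le)
    let f : K.coe →g (Subgraph.coeSubgraph K).coe :=
      { toFun := fun v => ⟨v.1.1, v.1, v.2, rfl⟩
        map_rel' := fun {u v} h => ⟨u.1, v.1, h, rfl, rfl⟩ }
    refine lt_of_le_of_lt (chromaticNumber_le_iff_colorable.2 (hc.of_hom f)) ?_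
    exact_mod_cast Nat.lt_succ_self k

end SimpleGraph

lemma IsCritical.of_iso {V W : Type*} {G : SimpleGraph V} {G' : SimpleGraph W} {k : ℕ}
    (e : G ≃g G') (h : IsCritical G k) : IsCritical G' k := by
  refine ⟨(chromaticNumber_congr e).symm.trans h.1, fun K hK => ?_⟩
  refine lt_of_le_of_lt (chromaticNumber_mono_of_hom ?_) (h.2 (K.comap e.toHom) fun hK' => hK ?_)
  · exact
      { toFun := fun v => ⟨e.symm v.1, by simp⟩
        map_rel' := fun {u v} (huv : K.Adj u v) => by
          exact ⟨e.symm.map_adj_iff.2 huv.adj_sub, by simpa using huv⟩ }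
  · have hv (w : W) : w ∈ K.verts := by
      have : e.symm w ∈ (K.comap e.toHom).verts := hK' ▸ Set.mem_univ _
      simpa using this
    ext w x
    · simp [hv]
    · refine ⟨fun h => h.adj_sub, fun hwx => ?_⟩
      have : (K.comap e.toHom).Adj (e.symm w) (e.symm x) := hK' ▸ e.symm.map_adj_iff.2 hwx
      simpa using this.2

/-- A copy of the balanced complete `q`-partite graph with parts of size `m` forces at least
`m ^ ℓ` cliques of order `ℓ`. -/
lemma pow_le_cliqueCount {V : Type*} [Finite V] {G : SimpleGraph V} {q m ℓ : ℕ} (hℓ : ℓ ≤ q)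
    (φ : Fin q × Fin m → V) (hinj : Function.Injective φ)
    (hadj : ∀ x y, x.1 ≠ y.1 → G.Adj (φ x) (φ y)) : m ^ ℓ ≤ cliqueCount G ℓ := by
  classical
  let g : (Fin ℓ → Fin m) → Fin ℓ → V := fun f i => φ (Fin.castLE hℓ i, f i)
  have hg (f) : Function.Injective (g f) := fun i j hij => by
    simpa using congrArg Prod.fst (hinj hij)
  let F : (Fin ℓ → Fin m) → Finset V := fun f => Finset.univ.image (g f)
  have hF : Function.Injective F := fun f f' h => by
    funext i
    have : g f i ∈ F f' := h ▸ Finset.mem_image_of_mem _ (Finset.mem_univ i)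
    obtain ⟨j, -, hj⟩ := Finset.mem_image.1 this
    have h1 := hinj hj
    simp only [Prod.mk.injEq, Fin.castLE_inj] at h1
    obtain ⟨rfl, h2⟩ := h1
    exact h2.symm
  have hcard : (Set.range F).ncard = m ^ ℓ := by
    rw [← Set.image_univ, Set.ncard_image_of_injective _ hF, Set.ncard_univ]
    simp
  rw [← hcard]
  refine Set.ncard_le_ncard ?_ (Set.toFinite _)
  rintro _ ⟨f, rfl⟩
  refine ⟨?_, by simp [F, Finset.card_image_of_injective _ (hg f)]⟩
  intro x hx y hy hxy
  simp only [F, Finset.coe_image, Finset.coe_univ, Set.image_univ, Set.mem_range] at hx hy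
  obtain ⟨i, rfl⟩ := hx
  obtain ⟨j, rfl⟩ := hy
  refine hadj _ _ fun h => hxy ?_
  have : i = j := by simpa using h
  rw [this]

/-- Adjacency in the generalized Toft graph: the vertices `inl (i, t)` form a complete `q`-partite
graph with parts of size `m`, the vertices `inr (i, t)` form `q` disjoint cycles of length `m`, and
`inr (i, t)` is joined to every `inl (j, t)` with `j ≠ i`. -/
def toftAdj (q m : ℕ) :
    (Fin q × Fin m) ⊕ (Fin q × Fin m) → (Fin q × Fin m) ⊕ (Fin q × Fin m) → Prop
  | .inl x, .inl y => x.1 ≠ y.1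
  | .inr x, .inr y => x.1 = y.1 ∧ (cycleGraph m).Adj x.2 y.2
  | .inl x, .inr y => x.1 ≠ y.1 ∧ x.2 = y.2
  | .inr x, .inl y => x.1 ≠ y.1 ∧ x.2 = y.2

/-- The generalized Toft graph. -/
def toftGraph (q m : ℕ) : SimpleGraph ((Fin q × Fin m) ⊕ (Fin q × Fin m)) where
  Adj := toftAdj q m
  symm := ⟨by
    rintro (x | x) (y | y) h
    · exact Ne.symm h
    · exact ⟨h.1.symm, h.2.symm⟩
    · exact ⟨h.1.symm, h.2.symm⟩
    · exact ⟨h.1.symm, h.2.symm⟩⟩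
  loopless := ⟨by
    rintro (x | x) h
    · exact h rfl
    · exact h.2.ne rfl⟩

/-- In a `(q + 1)`-colouring of the generalized Toft graph, all parts of the complete multipartite
graph except possibly one are monochromatic. -/
lemma toftGraph_exists_monochromatic {q m : ℕ} [NeZero m] (hq : 0 < q)
    (C : (toftGraph q m).Coloring (Fin (q + 1))) :
    ∃ j : Fin q, ∀ i ≠ j, ∀ t, C (.inl (i, t)) = C (.inl (i, 0)) := by
  by_contra! h
  obtain ⟨i, -, t, ht⟩ := h ⟨0, hq⟩
  obtain ⟨j, hji, u, hu⟩ := h i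
  have hC (x y : Fin q × Fin m) (hxy : x.1 ≠ y.1) : C (.inl x) ≠ C (.inl y) :=
    C.valid (v := .inl x) (w := .inl y) hxy
  let f : Option (Option (Fin q)) → Fin q × Fin m
    | none => (i, t)
    | some none => (j, u)
    | some (some l) => (l, 0)
  have hf : Function.Injective fun x => C (.inl (f x)) := by
    intro x y hxy
    by_contra hne
    by_cases h1 : (f x).1 = (f y).1
    · rcases x with _ | _ | l <;> rcases y with _ | _ | l' <;> simp_all [f]
    · exact hC _ _ h1 hxy
  have := Fintype.card_le_of_injective _ hf
  simp at this

lemma toftGraph_not_colorable {q m : ℕ} (hq : 0 < q) (hm : 2 ≤ m) (hodd : Odd m) :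
    ¬ (toftGraph q m).Colorable (q + 1) := by
  classical
  rintro ⟨C⟩
  have : NeZero m := ⟨by omega⟩
  obtain ⟨j, hj⟩ := toftGraph_exists_monochromatic hq C
  let S : Finset (Fin (q + 1)) := ((Finset.univ.erase j).image fun i => C (.inl (i, 0)))ᶜ
  have hS : S.card = 2 := by
    rw [Finset.card_compl, Finset.card_image_of_injOn, Finset.card_erase_of_mem (Finset.mem_univ j)]
    · simp
      omega
    · intro x _ y _ hxy
      by_contra hne
      exact C.valid (v := .inl (x, 0)) (w := .inl (y, 0)) hne hxy
  have hmem (t : Fin m) : C (.inr (j, t)) ∈ S := by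
    simp only [S, Finset.mem_compl, Finset.mem_image, Finset.mem_erase, Finset.mem_univ, and_true,
      not_exists, not_and]
    intro i hi h
    rw [← hj i hi t] at h
    exact C.valid (v := .inl (i, t)) (w := .inr (j, t)) ⟨hi, rfl⟩ h
  have D : (cycleGraph m).Coloring S :=
    Coloring.mk (fun t => ⟨C (.inr (j, t)), hmem t⟩) fun {t u} htu h =>
      C.valid (v := .inr (j, t)) (w := .inr (j, u)) ⟨rfl, htu⟩ (congrArg Subtype.val h)
  have hD := D.colorable
  rw [Fintype.card_coe, hS] at hD
  exact not_colorable_two_cycleGraph hm hodd hD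

/-- Along an edge of a cycle avoiding the vertex `p`, the distance from `p` changes parity. -/
lemma cycleGraph_even_val_sub_ne {m : ℕ} {p t u : Fin (m + 2)} (h : (cycleGraph (m + 2)).Adj t u)
    (ht : t ≠ p) (hu : u ≠ p) : ¬ (Even (t - p).val ↔ Even (u - p).val) := by
  wlog htu : t - u = 1 generalizing t u
  · rw [iff_comm]
    exact this h.symm hu ht ((cycleGraph_adj.1 h).resolve_left htu)
  have h1 : t - p = (u - p) + 1 := by rw [← htu]; abel
  have h2 := Fin.val_add_one (u - p)
  rw [← h1] at h2
  split_ifs at h2 with h3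
  · exact absurd (sub_eq_zero.1 (Fin.ext h2)) ht
  · rw [h2]
    grind

lemma toftGraph_deleteEdges_colorable {q m : ℕ} {x y : Fin q × Fin (m + 2)} (hxy : x.1 ≠ y.1) :
    ((toftGraph q (m + 2)).deleteEdges {s(.inl x, .inl y)}).Colorable (q + 1) := by
  classical
  let f : (Fin q × Fin (m + 2)) ⊕ (Fin q × Fin (m + 2)) → Option (Fin q)
    | .inl z => if z = x ∨ z = y then none else some z.1
    | .inr z =>
      if z.2 = x.2 ∧ z.1 ≠ x.1 then some x.1
      else if z.2 = y.2 ∧ z.1 ≠ y.1 then some y.1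
      else if Even (z.2 - (if z.1 = x.1 then y.2 else x.2)).val then none else some z.1
  have hcross (z w : Fin q × Fin (m + 2)) (h1 : z.1 ≠ w.1) (h2 : z.2 = w.2) :
      f (.inl z) ≠ f (.inr w) := by
    obtain ⟨i, t⟩ := z
    obtain ⟨l, u⟩ := w
    obtain ⟨i₀, t₀⟩ := x
    obtain ⟨j₀, u₀⟩ := y
    simp only at h1 h2 hxy
    subst h2
    simp only [f, Prod.mk.injEq]
    grind
  have D : ((toftGraph q (m + 2)).deleteEdges {s(.inl x, .inl y)}).Coloring (Option (Fin q)) := by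
    refine Coloring.mk f ?_
    rintro (z | z) (w | w) h
    · obtain ⟨h1, h2⟩ := (deleteEdges_adj ..).1 h
      replace h1 : z.1 ≠ w.1 := h1
      simp only [Set.mem_singleton_iff, Sym2.eq_iff, Sum.inl.injEq] at h2
      simp only [f]
      grind
    · obtain ⟨h1, h2⟩ := ((deleteEdges_adj ..).1 h).1
      exact hcross z w h1 h2
    · obtain ⟨h1, h2⟩ := ((deleteEdges_adj ..).1 h).1
      exact (hcross w z h1.symm h2.symm).symm
    · obtain ⟨h1, h2⟩ := ((deleteEdges_adj ..).1 h).1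
      have h3 := h2.ne
      obtain ⟨l, t⟩ := z
      obtain ⟨l', u⟩ := w
      obtain rfl : l = l' := h1
      have h4 (p) := cycleGraph_even_val_sub_ne (p := p) h2
      simp only [f]
      simp only at h3 h4
      grind
  simpa using D.colorable

/-- Stiebitz: for every `k ≥ 4` there is a constant `c_k > 0` such that for
infinitely many `n` there is a `k`-critical graph `G` on `n` vertices with
`t_ℓ(G) ≥ c_k · n^ℓ` for every `2 ≤ ℓ ≤ k - 2`. -/
theorem many_cliques_in_critical_graphs {k : ℕ} (hk : 4 ≤ k) :
    ∃ c : ℝ, 0 < c ∧ ∀ N : ℕ, ∃ n : ℕ, N ≤ n ∧ ∃ G : SimpleGraph (Fin n),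
      IsCritical G k ∧ ∀ ℓ : ℕ, 2 ≤ ℓ → ℓ ≤ k - 2 →
        c * (n : ℝ) ^ ℓ ≤ (cliqueCount G ℓ : ℝ) := by
  classical
  obtain ⟨q, rfl⟩ : ∃ q, k = q + 2 := ⟨k - 2, by omega⟩
  have hq : 2 ≤ q := by omega
  have hq0 : (0 : ℝ) < 2 * q := by positivity
  refine ⟨(1 / (2 * q)) ^ q, by positivity, fun N => ?_⟩
  obtain ⟨m, hm⟩ : ∃ m, m = 2 * N + 1 := ⟨_, rfl⟩
  have hnot := toftGraph_not_colorable (q := q) (m := m + 2) (by omega) (by omega)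
    ⟨N + 1, by omega⟩
  let i₀ : Fin q := ⟨0, by omega⟩
  let i₁ : Fin q := ⟨1, by omega⟩
  have h01 : i₀ ≠ i₁ := by simp [i₀, i₁]
  obtain ⟨H, hH⟩ := exists_isCritical_subgraph
    (toftGraph_deleteEdges_colorable (x := (i₀, (0 : Fin (m + 2)))) (y := (i₁, 0))
      h01).of_deleteEdges_singleton hnot
  have hadj (x y : Fin q × Fin (m + 2)) (hxy : x.1 ≠ y.1) : H.Adj (.inl x) (.inl y) := by
    by_contra h
    have hc : H.coe.Colorable (q + 1) := (toftGraph_deleteEdges_colorable hxy).of_hom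
      { toFun := Subtype.val
        map_rel' := fun {u v} (huv : H.Adj u v) => by
          refine (deleteEdges_adj ..).2 ⟨huv.adj_sub, fun he => h ?_⟩
          rcases Sym2.eq_iff.1 he with ⟨h1, h2⟩ | ⟨h1, h2⟩
          · rwa [h1, h2] at huv
          · rw [h1, h2] at huv
            exact huv.symm }
    have := chromaticNumber_le_iff_colorable.2 hc
    rw [hH.1] at this
    norm_cast at this
    omega
  have hmem (x : Fin q × Fin (m + 2)) : (.inl x) ∈ H.verts := by
    by_cases hx : x.1 = i₀
    · exact (hadj x (i₁, 0) (hx ▸ h01)).fst_mem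
    · exact (hadj x (i₀, 0) hx).fst_mem
  let e := Fintype.equivFin H.verts
  let n := Fintype.card H.verts
  let φ : Fin q × Fin (m + 2) → Fin n := fun x => e ⟨.inl x, hmem x⟩
  have hφ : Function.Injective φ := fun x y h => by simpa [φ] using h
  have hcard := Fintype.card_le_of_injective φ hφ
  have hn : n ≤ 2 * q * (m + 2) := by
    have := Fintype.card_subtype_le (· ∈ H.verts)
    simp only [Fintype.card_sum, Fintype.card_prod, Fintype.card_fin] at this
    calc n ≤ _ := this
      _ = _ := by ring
  refine ⟨n, ?_, H.coe.map e.toEmbedding, hH.of_iso (Iso.map e H.coe), fun ℓ _ hℓ => ?_⟩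
  · simp only [Fintype.card_prod, Fintype.card_fin] at hcard
    nlinarith
  · have hcl := pow_le_cliqueCount (G := H.coe.map e.toEmbedding) (ℓ := ℓ) hℓ φ hφ fun x y hxy =>
      (Iso.map e H.coe).map_adj_iff.2 (hadj x y hxy)
    have hn' : (n : ℝ) ≤ 2 * q * (m + 2 : ℕ) := by exact_mod_cast hn
    have h1 : 1 / (2 * q : ℝ) ≤ 1 := by
      rw [div_le_one hq0]
      have : (2 : ℝ) ≤ q := by exact_mod_cast hq
      linarith
    calc (1 / (2 * q : ℝ)) ^ q * (n : ℝ) ^ ℓ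
        ≤ (1 / (2 * q)) ^ ℓ * (2 * q * (m + 2 : ℕ)) ^ ℓ := by
          gcongr ?_ * ?_ ^ _
          exact pow_le_pow_of_le_one (by positivity) h1 hℓ
      _ = ((m + 2 : ℕ) : ℝ) ^ ℓ := by
          rw [← mul_pow]
          congr 1
          field_simp
      _ ≤ cliqueCount (H.coe.map e.toEmbedding) ℓ := by exact_mod_cast hcl
end

section
/- Let 4 ≤ k ≤ 7 and let G be a k-critical graph on n > k vertices. Then G has an edge that is contained in at most one copy of K_{k-1}. -/
open SimpleGraph

namespace SimpleGraph

/-- `c` is a colouring of `G` whose only monochromatic edge is the one joining `u` and `v`. -/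
structure IsDefectColoring {V α : Type*} (G : SimpleGraph V) (u v : V) (c : V → α) : Prop where
  eq : c u = c v
  mono : ∀ x y, G.Adj x y → c x = c y → s(x, y) = s(u, v)

section Colorings

variable {V : Type*} {G : SimpleGraph V} {m : ℕ} {u v : V} {c : V → Fin m} {T : Finset V}

theorem IsDefectColoring.injOn (hc : G.IsDefectColoring u v c) (hT : G.IsClique (T : Set V))
    (h : ¬ (u ∈ T ∧ v ∈ T)) : Set.InjOn c T := by
  intro x hx y hy hxy
  by_contra hne
  have := hc.mono x y (hT hx hy hne) hxy
  rw [Sym2.eq_iff] at this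
  rcases this with ⟨rfl, rfl⟩ | ⟨rfl, rfl⟩
  · exact h ⟨hx, hy⟩
  · exact h ⟨hy, hx⟩

theorem exists_color_of_injOn (hinj : Set.InjOn c T) (hcard : T.card = m) (i : Fin m) :
    ∃ x ∈ T, c x = i := by
  have h : T.image c = Finset.univ := by
    apply Finset.eq_univ_of_card
    rw [Finset.card_image_of_injOn hinj, hcard, Fintype.card_fin]
  have := Finset.mem_univ i
  rw [← h, Finset.mem_image] at this
  exact this

theorem card_color_of_injOn (hinj : Set.InjOn c T) (hcard : T.card = m) (i : Fin m) :
    (T.filter (c · = i)).card = 1 := by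
  obtain ⟨x, hx, hxi⟩ := exists_color_of_injOn hinj hcard i
  rw [Finset.card_eq_one]
  refine ⟨x, ?_⟩
  ext y
  simp only [Finset.mem_filter, Finset.mem_singleton]
  constructor
  · rintro ⟨hy, hyi⟩
    exact hinj hy hx (hyi.trans hxi.symm)
  · rintro rfl
    exact ⟨hx, hxi⟩

theorem IsDefectColoring.card_color (hc : G.IsDefectColoring u v c) (hT : G.IsNClique m T)
    (h : ¬ (u ∈ T ∧ v ∈ T)) (i : Fin m) : (T.filter (c · = i)).card = 1 :=
  card_color_of_injOn (hc.injOn hT.isClique h) hT.card_eq i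

theorem IsDefectColoring.card_color_eq_two [DecidableEq V] (hc : G.IsDefectColoring u v c)
    (huv : G.Adj u v) (hT : G.IsClique (T : Set V)) (hu : u ∈ T) (hv : v ∈ T) :
    (T.filter (c · = c u)).card = 2 := by
  have : T.filter (c · = c u) = {u, v} := by
    ext x
    simp only [Finset.mem_filter, Finset.mem_insert, Finset.mem_singleton]
    constructor
    · rintro ⟨hx, hxc⟩
      by_contra! hne
      have := hc.mono x u (hT hx hu hne.1) hxc
      rw [Sym2.eq_iff] at this
      grind
    · rintro (rfl | rfl)
      · exact ⟨hu, rfl⟩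
      · exact ⟨hv, hc.eq.symm⟩
  rw [this, Finset.card_pair huv.ne]

/-- Distinct `m`-cliques `S`, `T` with a common vertex `a` cannot be matched with `m`-cliques
`S'`, `T'` avoiding `a` so that `S'` and `T` have the same multiset union as `T'` and `S`. -/
theorem exchange_false [DecidableEq V]
    (hE : ∀ u v, G.Adj u v → ∃ c : V → Fin m, G.IsDefectColoring u v c)
    {S S' T' : Finset V} (hS : G.IsNClique m S) (hT : G.IsNClique m T)
    (hS' : G.IsNClique m S') (hT' : G.IsNClique m T') (hST : S ≠ T) {a : V}
    (haS : a ∈ S) (haT : a ∈ T) (haS' : a ∉ S') (haT' : a ∉ T')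
    (hunion : S' ∪ T = T' ∪ S) (hinter : S' ∩ T = T' ∩ S) : False := by
  obtain ⟨w, hwS, hwT⟩ : ∃ w ∈ S, w ∉ T := by
    by_contra! h
    exact hST (Finset.eq_of_subset_of_card_le h (by rw [hS.card_eq, hT.card_eq]))
  have haw : a ≠ w := by
    rintro rfl
    exact hwT haT
  have hadj : G.Adj a w := hS.isClique haS hwS haw
  obtain ⟨c, hc⟩ := hE a w hadj
  have e1 := hc.card_color_eq_two hadj hS.isClique haS hwS
  have e2 := hc.card_color hT (fun h => hwT h.2) (c a)
  have e3 := hc.card_color hS' (fun h => haS' h.1) (c a)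
  have e4 := hc.card_color hT' (fun h => haT' h.1) (c a)
  have h1 := Finset.card_union_add_card_inter (S'.filter (c · = c a)) (T.filter (c · = c a))
  have h2 := Finset.card_union_add_card_inter (T'.filter (c · = c a)) (S.filter (c · = c a))
  rw [← Finset.filter_union, ← Finset.filter_inter_distrib] at h1 h2
  rw [hunion, hinter] at h1
  omega

end Colorings

section Independence

variable {V : Type*} [Fintype V] [DecidableEq V] {G : SimpleGraph V} [DecidableRel G.Adj] {m : ℕ}

theorem sum_cliques_of_finset (a : Finset V → ℚ) (s : Finset V) :
    ∑ w ∈ s, ∑ T ∈ G.cliqueFinset m with w ∈ T, a T =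
      ∑ T ∈ G.cliqueFinset m, a T * ((T.filter (· ∈ s)).card : ℚ) := by
  simp only [Finset.sum_filter]
  rw [Finset.sum_comm]
  refine Finset.sum_congr rfl fun T _ => ?_
  rw [← Finset.sum_filter, Finset.sum_const, nsmul_eq_mul, mul_comm]
  congr 3
  ext x
  simp [and_comm]

/-- Weights on the `m`-cliques which sum to zero at every vertex also sum to zero at every edge. -/
theorem sum_edge_eq_zero (hm : 0 < m)
    (hE : ∀ u v, G.Adj u v → ∃ c : V → Fin m, G.IsDefectColoring u v c)
    (a : Finset V → ℚ) (h0 : ∀ w, ∑ T ∈ G.cliqueFinset m with w ∈ T, a T = 0) (u v : V) :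
    ∑ T ∈ G.cliqueFinset m with u ∈ T ∧ v ∈ T, a T = 0 := by
  by_cases huv : u = v
  · subst huv
    simpa using h0 u
  by_cases hadj : G.Adj u v
  · obtain ⟨c, hc⟩ := hE u v hadj
    have h1 := sum_cliques_of_finset (G := G) (m := m) a Finset.univ
    have h2 := sum_cliques_of_finset (G := G) (m := m) a (Finset.univ.filter (c · = c u))
    simp only [h0, Finset.sum_const_zero] at h1 h2
    have h3 : ∑ T ∈ G.cliqueFinset m, a T = 0 := by
      have : ∑ T ∈ G.cliqueFinset m, a T * ((T.filter (· ∈ Finset.univ)).card : ℚ) =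
          (∑ T ∈ G.cliqueFinset m, a T) * m := by
        rw [Finset.sum_mul]
        refine Finset.sum_congr rfl fun T hT => ?_
        rw [mem_cliqueFinset_iff] at hT
        simp [hT.card_eq]
      rw [this] at h1
      have hm' : (m : ℚ) ≠ 0 := by positivity
      exact (mul_eq_zero.1 h1.symm).resolve_right hm'
    have h4 : ∑ T ∈ G.cliqueFinset m,
        a T * ((T.filter (· ∈ Finset.univ.filter (c · = c u))).card : ℚ) =
        ∑ T ∈ G.cliqueFinset m, (a T + if u ∈ T ∧ v ∈ T then a T else 0) := by
      refine Finset.sum_congr rfl fun T hT => ?_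
      rw [mem_cliqueFinset_iff] at hT
      simp only [Finset.mem_filter, Finset.mem_univ, true_and]
      split_ifs with h
      · rw [hc.card_color_eq_two hadj hT.isClique h.1 h.2]
        push_cast
        ring
      · rw [hc.card_color hT h]
        simp
    rw [h4, Finset.sum_add_distrib, h3, zero_add, ← Finset.sum_filter] at h2
    exact h2.symm
  · apply Finset.sum_eq_zero
    intro T hT
    rw [Finset.mem_filter, mem_cliqueFinset_iff] at hT
    exact absurd (hT.1.isClique hT.2.1 hT.2.2 huv) hadj

/-- The characteristic vectors of the `m`-cliques are linearly independent. -/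
theorem weights_eq_zero (hm : 0 < m)
    (hE : ∀ u v, G.Adj u v → ∃ c : V → Fin m, G.IsDefectColoring u v c)
    (a : Finset V → ℚ) (h0 : ∀ w, ∑ T ∈ G.cliqueFinset m with w ∈ T, a T = 0)
    {T₀ : Finset V} (hT₀ : T₀ ∈ G.cliqueFinset m) : a T₀ = 0 := by
  have key : ∀ S : Finset V, ∀ w,
      ∑ T ∈ G.cliqueFinset m with w ∈ T, (if S ⊆ T then a T else 0) = 0 := by
    intro S
    induction S using Finset.induction_on with
    | empty => simpa using h0
    | insert u S _ ih =>
      intro w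
      have := sum_edge_eq_zero hm hE _ ih u w
      rw [Finset.sum_filter] at this ⊢
      rw [← this]
      refine Finset.sum_congr rfl fun T _ => ?_
      simp only [Finset.insert_subset_iff]
      split_ifs <;> tauto
  rw [mem_cliqueFinset_iff] at hT₀
  obtain ⟨w, hw⟩ : T₀.Nonempty := by
    rw [← Finset.card_pos, hT₀.card_eq]
    exact hm
  have := key T₀ w
  rw [Finset.sum_eq_single T₀] at this
  · simpa using this
  · intro T hT hne
    rw [Finset.mem_filter, mem_cliqueFinset_iff] at hT
    rw [if_neg]
    intro hsub
    exact hne (Finset.eq_of_subset_of_card_le hsub (by rw [hT.1.card_eq, hT₀.card_eq])).symm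
  · intro h
    simp [hT₀, hw] at h

/-- The linear map sending weights on the `m`-cliques to the induced vertex weights. -/
def cliqueWeightMap (G : SimpleGraph V) [DecidableRel G.Adj] (m : ℕ) :
    (G.cliqueFinset m → ℚ) →ₗ[ℚ] (V → ℚ) where
  toFun a w := ∑ T : G.cliqueFinset m, if w ∈ T.1 then a T else 0
  map_add' a b := by
    ext w
    simp only [Pi.add_apply, ← Finset.sum_add_distrib]
    refine Finset.sum_congr rfl fun T _ => ?_
    split_ifs <;> simp
  map_smul' r a := by
    ext w
    simp [Finset.mul_sum]

theorem cliqueWeightMap_injective (hm : 0 < m)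
    (hE : ∀ u v, G.Adj u v → ∃ c : V → Fin m, G.IsDefectColoring u v c) :
    Function.Injective (G.cliqueWeightMap m) := by
  rw [injective_iff_map_eq_zero]
  intro a ha
  ext ⟨T₀, hT₀⟩
  have := weights_eq_zero hm hE (fun T => if h : T ∈ G.cliqueFinset m then a ⟨T, h⟩ else 0)
    (fun w => ?_) hT₀
  · simpa [hT₀] using this
  · have hw : ∑ T : G.cliqueFinset m, (if w ∈ T.1 then a T else 0) = 0 := congrFun ha w
    rw [Finset.sum_filter, ← Finset.sum_attach]
    refine Eq.trans ?_ hw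
    refine Finset.sum_congr rfl fun T _ => ?_
    simp only [T.2, dif_pos]

theorem card_cliqueFinset_le_card (hm : 0 < m)
    (hE : ∀ u v, G.Adj u v → ∃ c : V → Fin m, G.IsDefectColoring u v c) :
    (G.cliqueFinset m).card ≤ Fintype.card V := by
  have := LinearMap.finrank_le_finrank_of_injective (cliqueWeightMap_injective hm hE)
  rwa [Module.finrank_fintype_fun_eq_card, Module.finrank_fintype_fun_eq_card,
    Fintype.card_coe] at this

/-- When there are as many `m`-cliques as vertices, a function summing to zero over every
`m`-clique vanishes. -/
theorem eq_zero_of_sum_clique_eq_zero (hm : 0 < m)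
    (hE : ∀ u v, G.Adj u v → ∃ c : V → Fin m, G.IsDefectColoring u v c)
    (hcard : (G.cliqueFinset m).card = Fintype.card V) (f : V → ℚ)
    (hf : ∀ T ∈ G.cliqueFinset m, ∑ x ∈ T, f x = 0) : f = 0 := by
  have hsurj : Function.Surjective (G.cliqueWeightMap m) :=
    (LinearMap.injective_iff_surjective_of_finrank_eq_finrank
      (by rw [Module.finrank_fintype_fun_eq_card, Module.finrank_fintype_fun_eq_card,
        Fintype.card_coe, hcard])).1 (cliqueWeightMap_injective hm hE)
  obtain ⟨a, ha⟩ := hsurj f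
  have hsq : ∑ x, f x * f x = 0 := by
    calc ∑ x, f x * f x
        = ∑ x, ∑ T : G.cliqueFinset m, if x ∈ T.1 then a T * f x else 0 := by
          refine Finset.sum_congr rfl fun x _ => ?_
          have hx : f x = ∑ T : G.cliqueFinset m, if x ∈ T.1 then a T else 0 :=
            (congrFun ha x).symm
          nth_rw 1 [hx]
          simp only [Finset.sum_mul, ite_mul, zero_mul]
      _ = ∑ T : G.cliqueFinset m, a T * ∑ x ∈ T.1, f x := by
          rw [Finset.sum_comm]
          refine Finset.sum_congr rfl fun T _ => ?_
          rw [Finset.mul_sum, Finset.sum_ite_mem, Finset.univ_inter]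
      _ = 0 := Finset.sum_eq_zero fun T _ => by rw [hf T.1 T.2, mul_zero]
  rw [Finset.sum_eq_zero_iff_of_nonneg fun x _ => mul_self_nonneg _] at hsq
  ext x
  exact mul_self_eq_zero.1 (hsq x (Finset.mem_univ x))

end Independence

section Star

variable {V : Type*} [Fintype V] [DecidableEq V] {G : SimpleGraph V} [DecidableRel G.Adj] {m : ℕ}

/-- If `v` lies in at most five `m`-cliques, and every edge at `v` lies in at least two, then every
edge of the graph lies in an `m`-clique containing `v`. -/
theorem exists_clique_of_card_le_five
    (hE : ∀ u v, G.Adj u v → ∃ c : V → Fin m, G.IsDefectColoring u v c)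
    (h2 : ∀ u v, G.Adj u v → 2 ≤ ((G.cliqueFinset m).filter fun T => u ∈ T ∧ v ∈ T).card)
    {v : V} (hv : ∃ u, G.Adj v u)
    (h5 : ((G.cliqueFinset m).filter (v ∈ ·)).card ≤ 5) {x y : V} (hxy : G.Adj x y) :
    ∃ T ∈ G.cliqueFinset m, v ∈ T ∧ x ∈ T ∧ y ∈ T := by
  by_contra! hout
  obtain ⟨c, hc⟩ := hE x y hxy
  set F := (G.cliqueFinset m).filter (v ∈ ·) with hF
  have memF : ∀ T, T ∈ F ↔ G.IsNClique m T ∧ v ∈ T := by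
    intro T
    rw [hF, Finset.mem_filter, mem_cliqueFinset_iff]
  set I : V → Finset (Finset V) := fun a => F.filter (a ∈ ·) with hI
  have memI : ∀ a T, T ∈ I a ↔ T ∈ F ∧ a ∈ T := by
    intro a T
    rw [hI, Finset.mem_filter]
  have Isub : ∀ a, I a ⊆ F := fun a => Finset.filter_subset _ _
  have Iv : I v = F := by
    ext T
    rw [memI, memF]
    tauto
  have hinj : ∀ T ∈ F, Set.InjOn c T := by
    intro T hT
    rw [memF] at hT
    refine hc.injOn hT.1.isClique fun h => ?_
    exact hout T ((mem_cliqueFinset_iff).2 hT.1) hT.2 h.1 h.2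
  have adj : ∀ a b, a ≠ b → (I a ∩ I b).Nonempty → G.Adj a b := by
    rintro a b hab ⟨T, hT⟩
    rw [Finset.mem_inter, memI, memI, memF] at hT
    exact hT.1.1.1.isClique hT.1.2 hT.2.2 hab
  have two_le : ∀ a, (I a).Nonempty → 2 ≤ (I a).card := by
    intro a ha
    have aux : ∀ w, G.Adj v w → 2 ≤ (I w).card := by
      intro w hw
      refine (h2 v w hw).trans (le_of_eq ?_)
      congr 1
      ext T
      rw [Finset.mem_filter, memI, memF, mem_cliqueFinset_iff]
      tauto
    by_cases hav : v = a
    · obtain ⟨u, hu⟩ := hv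
      rw [← hav, Iv]
      exact (aux u hu).trans (Finset.card_le_card (Isub u))
    · apply aux
      apply adj _ _ hav
      rw [Iv, Finset.inter_eq_right.2 (Isub a)]
      exact ha
  have disj : ∀ a b, c a = c b → a ≠ b → Disjoint (I a) (I b) := by
    intro a b hab hne
    rw [Finset.disjoint_left]
    intro T ha hb
    rw [memI] at ha hb
    exact hne (hinj T ha.1 ha.2 hb.2 hab)
  have rep : ∀ T ∈ F, ∀ i, ∃ b ∈ T, c b = i := fun T hT i =>
    exists_color_of_injOn (hinj T hT) ((memF T).1 hT).1.card_eq i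
  have compl : ∀ a, (I a).Nonempty → I a ≠ F → ∃ b, c b = c a ∧ I b = F \ I a := by
    intro a ha haF
    obtain ⟨T, hTF, hTa⟩ : ∃ T ∈ F, T ∉ I a := by
      by_contra! h
      exact haF (Finset.Subset.antisymm (Isub a) h)
    obtain ⟨b, hbT, hbc⟩ := rep T hTF (c a)
    have hTb : T ∈ I b := (memI b T).2 ⟨hTF, hbT⟩
    have hab : a ≠ b := by
      rintro rfl
      exact hTa hTb
    have hd := disj a b hbc.symm hab
    refine ⟨b, hbc, ?_⟩
    apply Finset.Subset.antisymm
    · intro T' hT'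
      exact Finset.mem_sdiff.2 ⟨Isub b hT', fun h => Finset.disjoint_left.1 hd h hT'⟩
    · intro T' hT'
      rw [Finset.mem_sdiff] at hT'
      by_contra hT'b
      obtain ⟨d, hdT, hdc⟩ := rep T' hT'.1 (c a)
      have hTd : T' ∈ I d := (memI d T').2 ⟨hT'.1, hdT⟩
      have hda : a ≠ d := by
        rintro rfl
        exact hT'.2 hTd
      have hdb : b ≠ d := by
        rintro rfl
        exact hT'b hTd
      have h1 := disj a d hdc.symm hda
      have h2' := disj b d (hbc.trans hdc.symm) hdb
      have hcard : (I a ∪ I b ∪ I d).card = (I a).card + (I b).card + (I d).card := by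
        rw [Finset.card_union_of_disjoint (Finset.disjoint_union_left.2 ⟨h1, h2'⟩),
          Finset.card_union_of_disjoint hd]
      have hle : (I a ∪ I b ∪ I d).card ≤ 5 :=
        (Finset.card_le_card
          (Finset.union_subset (Finset.union_subset (Isub a) (Isub b)) (Isub d))).trans h5
      have := two_le a ha
      have := two_le b ⟨T, hTb⟩
      have := two_le d ⟨T', hTd⟩
      omega
  -- Some vertex lies in exactly two of the cliques at `v`.
  obtain ⟨a, haF, ha2⟩ : ∃ a, I a ≠ F ∧ (I a).card = 2 := by
    have hF2 : 1 < F.card := by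
      have := two_le v
      rw [Iv] at this
      obtain ⟨u, hu⟩ := hv
      have h := h2 v u hu
      refine this ?_
      obtain ⟨T, hT⟩ := Finset.card_pos.1 (lt_of_lt_of_le Nat.zero_lt_two h)
      rw [Finset.mem_filter] at hT
      exact ⟨T, Finset.mem_filter.2 ⟨hT.1, hT.2.1⟩⟩
    obtain ⟨T, hT, T', hT', hne⟩ := Finset.one_lt_card.1 hF2
    obtain ⟨a, haT, haT'⟩ : ∃ a ∈ T, a ∉ T' := by
      by_contra! h
      exact hne (Finset.eq_of_subset_of_card_le h
        (by rw [((memF T).1 hT).1.card_eq, ((memF T').1 hT').1.card_eq]))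
    have haF : I a ≠ F := by
      intro h
      rw [← h, memI] at hT'
      exact haT' hT'.2
    have hane : (I a).Nonempty := ⟨T, (memI a T).2 ⟨hT, haT⟩⟩
    obtain ⟨b, -, hb⟩ := compl a hane haF
    have hsum := Finset.card_sdiff_add_card_eq_card (Isub a)
    rw [← hb] at hsum
    have ha := two_le a hane
    have hb2 : 2 ≤ (I b).card := by
      apply two_le
      rw [hb]
      refine ⟨T', Finset.mem_sdiff.2 ⟨hT', fun h => ?_⟩⟩
      exact haT' ((memI _ _).1 h).2
    by_cases h : (I a).card = 2
    · exact ⟨a, haF, h⟩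
    · refine ⟨b, fun h' => ?_, by omega⟩
      rw [h'] at hsum
      omega
  have hane : (I a).Nonempty := Finset.card_pos.1 (by omega)
  set P := I a with hP
  have hQne : (F \ P).Nonempty := by
    rw [Finset.sdiff_nonempty]
    exact fun h => haF (Finset.Subset.antisymm (Isub a) h)
  have hPQ : P ≠ F \ P := by
    intro h
    obtain ⟨T, hT⟩ := hane
    have := h ▸ hT
    rw [Finset.mem_sdiff] at this
    exact this.2 hT
  have hQF : F \ P ≠ F := by
    intro h
    obtain ⟨T, hT⟩ := hane
    have h' := Isub a hT
    rw [← h, Finset.mem_sdiff] at h'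
    exact h'.2 hT
  have PsubF : P ⊆ F := Isub a
  -- The vertices of type `P` and of type `F \ P` carry the same colours.
  have hcardPQ : (Finset.univ.filter fun z => I z = P).card =
      (Finset.univ.filter fun z => I z = F \ P).card := by
    have inj : ∀ R : Finset (Finset V), R ⊆ F → R.Nonempty →
        Set.InjOn c (Finset.univ.filter fun z => I z = R : Finset V) := by
      rintro R hR ⟨T, hT⟩ z hz z' hz' h
      simp only [Finset.coe_filter, Finset.mem_univ, true_and, Set.mem_ofPred_eq] at hz hz'
      exact hinj T (hR hT) ((memI z T).1 (hz ▸ hT)).2 ((memI z' T).1 (hz' ▸ hT)).2 h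
    rw [← Finset.card_image_of_injOn (inj P PsubF hane),
      ← Finset.card_image_of_injOn (inj _ Finset.sdiff_subset hQne)]
    congr 1
    ext i
    simp only [Finset.mem_image, Finset.mem_filter, Finset.mem_univ, true_and]
    constructor
    · rintro ⟨z, hz, rfl⟩
      obtain ⟨z', h1, h2⟩ := compl z (hz ▸ hane) (hz ▸ haF)
      exact ⟨z', hz ▸ h2, h1⟩
    · rintro ⟨z, hz, rfl⟩
      obtain ⟨z', h1, h2⟩ := compl z (hz ▸ hQne) (hz ▸ hQF)
      refine ⟨z', ?_, h1⟩
      rw [h2, hz, Finset.sdiff_sdiff_eq_self PsubF]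
  set D : Finset V → Finset V := fun T =>
    (T.filter fun z => I z ≠ P) ∪ Finset.univ.filter fun z => I z = F \ P with hD
  have memD : ∀ T z, z ∈ D T ↔ (z ∈ T ∧ I z ≠ P) ∨ I z = F \ P := by
    intro T z
    simp [hD]
  have notP : ∀ T ∈ P, ∀ z, I z = F \ P → z ∉ T := by
    intro T hT z hz hzT
    have := (memI z T).2 ⟨PsubF hT, hzT⟩
    rw [hz, Finset.mem_sdiff] at this
    exact this.2 hT
  have isP : ∀ T ∈ P, ∀ z, I z = P → z ∈ T := fun T hT z hz =>
    ((memI z T).1 (hz ▸ hT)).2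
  have hDclique : ∀ T ∈ P, G.IsNClique m (D T) := by
    intro T hT
    have hTF := (memF T).1 (PsubF hT)
    have mixed : ∀ z z', z ≠ z' → z ∈ T → I z ≠ P → I z' = F \ P → G.Adj z z' := by
      intro z z' hne hz hzP hz'
      apply adj z z' hne
      by_contra h
      rw [Finset.not_nonempty_iff_eq_empty, ← Finset.disjoint_iff_inter_eq_empty, hz'] at h
      have hsub : I z ⊆ P := by
        intro S hS
        by_contra hSP
        exact Finset.disjoint_left.1 h hS (Finset.mem_sdiff.2 ⟨Isub z hS, hSP⟩)
      refine hzP (Finset.eq_of_subset_of_card_le hsub ?_)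
      rw [ha2]
      exact two_le z ⟨T, (memI z T).2 ⟨PsubF hT, hz⟩⟩
    refine ⟨?_, ?_⟩
    · intro z hz z' hz' hne
      rw [Finset.mem_coe, memD] at hz hz'
      rcases hz with hz | hz <;> rcases hz' with hz' | hz'
      · exact hTF.1.isClique hz.1 hz'.1 hne
      · exact mixed z z' hne hz.1 hz.2 hz'
      · exact (mixed z' z hne.symm hz'.1 hz'.2 hz).symm
      · apply adj z z' hne
        rw [hz, hz', Finset.inter_self]
        exact hQne
    · rw [hD, Finset.card_union_of_disjoint, ← hcardPQ, ← hTF.1.card_eq,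
        ← Finset.card_filter_add_card_filter_not (s := T) (fun z => I z = P), add_comm]
      · congr 2
        ext z
        simp only [Finset.mem_filter, Finset.mem_univ, true_and]
        exact ⟨fun h => ⟨isP T hT z h, h⟩, fun h => h.2⟩
      · rw [Finset.disjoint_left]
        intro z hz hz'
        rw [Finset.mem_filter] at hz hz'
        exact notP T hT z hz'.2 hz.1
  obtain ⟨S, T, hST, hPeq⟩ := Finset.card_eq_two.1 ha2
  have hS : S ∈ P := by simp [hPeq]
  have hT : T ∈ P := by simp [hPeq]
  have hSF := (memF S).1 (PsubF hS)
  have hTF := (memF T).1 (PsubF hT)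
  have haD : ∀ T, a ∉ D T := by
    intro T h
    rw [memD] at h
    rcases h with h | h
    · exact h.2 rfl
    · exact hPQ h
  refine exchange_false hE hSF.1 hTF.1 (hDclique S hS) (hDclique T hT) hST
    (isP S hS a rfl) (isP T hT a rfl) (haD S) (haD T) ?_ ?_
  · ext z
    rw [Finset.mem_union (s := D S), Finset.mem_union (s := D T), memD, memD]
    by_cases hzP : I z = P
    · simp only [isP S hS z hzP, isP T hT z hzP, or_true]
    · by_cases hzQ : I z = F \ P
      · simp only [hzQ, or_true, true_or]
      · simp only [hzP, hzQ, ne_eq, not_false_eq_true, and_true, or_false]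
        exact or_comm
  · ext z
    rw [Finset.mem_inter (s₁ := D S), Finset.mem_inter (s₁ := D T), memD, memD]
    by_cases hzQ : I z = F \ P
    · simp only [notP S hS z hzQ, notP T hT z hzQ, and_false]
    · simp only [hzQ, or_false, and_comm, and_left_comm]

end Star

section Average

variable {V : Type*} [Fintype V] [DecidableEq V] {G : SimpleGraph V} [DecidableRel G.Adj] {m : ℕ}

theorem sum_card_cliques_through :
    ∑ v, ((G.cliqueFinset m).filter (v ∈ ·)).card = (G.cliqueFinset m).card * m := by
  simp only [Finset.card_filter]
  rw [Finset.sum_comm, Finset.card_eq_sum_ones, Finset.sum_mul]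
  refine Finset.sum_congr rfl fun T hT => ?_
  rw [mem_cliqueFinset_iff] at hT
  rw [← Finset.card_filter, one_mul, Finset.filter_univ_mem, hT.card_eq]

/-- When there are as many `m`-cliques as vertices, every edge lies in at least `m - 1` of them. -/
theorem le_card_cliques_through_edge (hm : 2 ≤ m)
    (hE : ∀ u v, G.Adj u v → ∃ c : V → Fin m, G.IsDefectColoring u v c)
    (hcard : (G.cliqueFinset m).card = Fintype.card V) {u v : V} (huv : G.Adj u v) :
    m - 1 ≤ ((G.cliqueFinset m).filter fun T => u ∈ T ∧ v ∈ T).card := by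
  by_contra! hlt
  obtain ⟨c, hc⟩ := hE u v huv
  set Q := (G.cliqueFinset m).filter fun T => u ∈ T ∧ v ∈ T with hQ
  have missed : ∀ T ∈ Q, (Finset.univ \ T.image c).card ≤ 1 := by
    intro T hT
    rw [hQ, Finset.mem_filter, mem_cliqueFinset_iff] at hT
    have hinj : Set.InjOn c (T.erase u) := by
      refine hc.injOn (hT.1.isClique.subset (by simp)) ?_
      simp
    have h1 : (T.erase u).card = m - 1 := by
      rw [Finset.card_erase_of_mem hT.2.1, hT.1.card_eq]
    have h2 : m - 1 ≤ (T.image c).card := by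
      rw [← h1, ← Finset.card_image_of_injOn hinj]
      exact Finset.card_le_card (Finset.image_subset_image (Finset.erase_subset _ _))
    rw [← Finset.compl_eq_univ_sdiff, Finset.card_compl, Fintype.card_fin]
    omega
  obtain ⟨i, hi, hiu⟩ : ∃ i, (∀ T ∈ Q, ∃ x ∈ T, c x = i) ∧ i ≠ c u := by
    have h1 : (Q.biUnion fun T => Finset.univ \ T.image c).card ≤ Q.card * 1 :=
      Finset.card_biUnion_le_card_mul _ _ _ missed
    have h2 : (insert (c u) (Q.biUnion fun T => Finset.univ \ T.image c)).card <
        (Finset.univ : Finset (Fin m)).card := by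
      refine lt_of_le_of_lt (Finset.card_insert_le _ _) ?_
      rw [Finset.card_fin]
      omega
    obtain ⟨i, -, hi⟩ := Finset.exists_mem_notMem_of_card_lt_card h2
    rw [Finset.mem_insert, not_or] at hi
    refine ⟨i, fun T hT => ?_, hi.1⟩
    by_contra h
    refine hi.2 (Finset.mem_biUnion.2 ⟨T, hT, ?_⟩)
    simpa using h
  have hone : ∀ T ∈ G.cliqueFinset m, (T.filter (c · = i)).card = 1 := by
    intro T hT
    by_cases h : u ∈ T ∧ v ∈ T
    · have hTQ : T ∈ Q := Finset.mem_filter.2 ⟨hT, h⟩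
      rw [mem_cliqueFinset_iff] at hT
      obtain ⟨x, hx, hxi⟩ := hi T hTQ
      rw [Finset.card_eq_one]
      refine ⟨x, ?_⟩
      ext y
      simp only [Finset.mem_filter, Finset.mem_singleton]
      constructor
      · rintro ⟨hy, hyi⟩
        by_contra hne
        have := hc.mono y x (hT.isClique hy hx hne) (hyi.trans hxi.symm)
        rw [Sym2.eq_iff] at this
        rcases this with ⟨rfl, -⟩ | ⟨-, rfl⟩
        · exact hiu hyi.symm
        · exact hiu hxi.symm
      · rintro rfl
        exact ⟨hx, hxi⟩
    · rw [mem_cliqueFinset_iff] at hT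
      exact hc.card_color hT h i
  have hzero := eq_zero_of_sum_clique_eq_zero (by omega) hE hcard
    (fun x => 1 - (m : ℚ) * if c x = i then 1 else 0) (fun T hT => by
      have := hone T hT
      rw [mem_cliqueFinset_iff] at hT
      rw [Finset.sum_sub_distrib, ← Finset.mul_sum, ← Finset.sum_filter, Finset.sum_const,
        Finset.sum_const, this, hT.card_eq]
      simp)
  have := congrFun hzero u
  simp [Ne.symm hiu] at this

/-- In a graph without `(m + 1)`-cliques, some vertex lies in fewer than `m` of the `m`-cliques. -/
theorem exists_card_cliques_through_lt [Nonempty V] (hm : 4 ≤ m)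
    (hE : ∀ u v, G.Adj u v → ∃ c : V → Fin m, G.IsDefectColoring u v c)
    (hiso : ∀ v, ∃ u, G.Adj v u) (hfree : G.CliqueFree (m + 1)) :
    ∃ v, ((G.cliqueFinset m).filter (v ∈ ·)).card < m := by
  by_contra! hge
  have hle := card_cliqueFinset_le_card (by omega) hE
  have hsum := sum_card_cliques_through (G := G) (m := m)
  have hsum' : ∑ _v : V, m ≤ ∑ v, ((G.cliqueFinset m).filter (v ∈ ·)).card :=
    Finset.sum_le_sum fun v _ => hge v
  rw [Finset.sum_const, Finset.card_univ, smul_eq_mul] at hsum'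
  have hcard : (G.cliqueFinset m).card = Fintype.card V := by
    refine le_antisymm hle ?_
    rw [hsum] at hsum'
    exact Nat.le_of_mul_le_mul_right hsum' (by omega)
  obtain ⟨v, -, hv⟩ : ∃ v ∈ (Finset.univ : Finset V),
      ((G.cliqueFinset m).filter (v ∈ ·)).card ≤ m := by
    apply Finset.exists_le_of_sum_le Finset.univ_nonempty
    rw [hsum, hcard, Finset.sum_const, Finset.card_univ, smul_eq_mul]
  have hedge := fun u (hu : G.Adj v u) => le_card_cliques_through_edge (by omega) hE hcard hu
  set N := G.neighborFinset v with hN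
  have hsub : ∀ T ∈ G.cliqueFinset m, v ∈ T → T ⊆ insert v N := by
    intro T hT hvT x hx
    rw [mem_cliqueFinset_iff] at hT
    by_cases hxv : x = v
    · simp [hxv]
    · rw [Finset.mem_insert, hN, mem_neighborFinset]
      exact Or.inr (hT.isClique hvT hx (Ne.symm hxv))
  have hvN : v ∉ N := by simp [hN]
  have hNcard : N.card ≤ m := by
    have h1 : N.card * (m - 1) ≤
        ∑ u ∈ N, ((G.cliqueFinset m).filter fun T => v ∈ T ∧ u ∈ T).card := by
      rw [← smul_eq_mul]
      apply Finset.card_nsmul_le_sum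
      intro u hu
      exact hedge u (by simpa [hN] using hu)
    have h2 : ∑ u ∈ N, ((G.cliqueFinset m).filter fun T => v ∈ T ∧ u ∈ T).card =
        ((G.cliqueFinset m).filter (v ∈ ·)).card * (m - 1) := by
      simp only [← Finset.filter_filter]
      simp only [Finset.card_filter _ (Finset.filter _ _)]
      rw [Finset.sum_comm, Finset.card_eq_sum_ones, Finset.sum_mul]
      refine Finset.sum_congr rfl fun T hT => ?_
      rw [Finset.mem_filter] at hT
      rw [← Finset.card_filter, one_mul, Finset.filter_mem_eq_inter]
      have h3 : N ∩ T = T.erase v := by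
        ext x
        rw [Finset.mem_inter, Finset.mem_erase]
        constructor
        · rintro ⟨hx, hxT⟩
          exact ⟨fun h => hvN (h ▸ hx), hxT⟩
        · rintro ⟨hxv, hxT⟩
          exact ⟨(Finset.mem_insert.1 (hsub T hT.1 hT.2 hxT)).resolve_left hxv, hxT⟩
      rw [h3, Finset.card_erase_of_mem hT.2, ((mem_cliqueFinset_iff).1 hT.1).card_eq]
    rw [h2] at h1
    exact (Nat.le_of_mul_le_mul_right h1 (by omega)).trans hv
  have hNv : (insert v N).card = N.card + 1 := Finset.card_insert_of_notMem hvN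
  obtain ⟨u, hu⟩ := hiso v
  set Q := (G.cliqueFinset m).filter fun T => v ∈ T ∧ u ∈ T with hQ
  have hQ3 : 3 ≤ Q.card := le_trans (by omega) (hedge u hu)
  have memQ : ∀ T ∈ Q, G.IsNClique m T ∧ T ⊆ insert v N := by
    intro T hT
    rw [hQ, Finset.mem_filter] at hT
    exact ⟨(mem_cliqueFinset_iff).1 hT.1, hsub T hT.1 hT.2.1⟩
  have sdiff_card : ∀ T ∈ Q, (insert v N \ T).card = N.card + 1 - m := by
    intro T hT
    rw [Finset.card_sdiff_of_subset (memQ T hT).2, hNv, (memQ T hT).1.card_eq]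
  have hNm : N.card = m := by
    refine le_antisymm hNcard ?_
    by_contra! hlt
    obtain ⟨T, hT, T', hT', hne⟩ := Finset.one_lt_card.1 (show 1 < Q.card by omega)
    have full : ∀ T ∈ Q, T = insert v N := fun T hT =>
      Finset.eq_of_subset_of_card_le (memQ T hT).2 (by rw [(memQ T hT).1.card_eq]; omega)
    exact hne ((full T hT).trans (full T' hT').symm)
  refine hfree (insert v N) ⟨?_, by omega⟩
  intro y hy z hz hyz
  have missing : ∀ x ∈ insert v N, (Q.filter (x ∉ ·)).card ≤ 1 := by
    intro x hx
    rw [Finset.card_le_one]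
    have key : ∀ T ∈ Q.filter (x ∉ ·), T = (insert v N).erase x := by
      intro T hT
      rw [Finset.mem_filter] at hT
      apply Finset.eq_of_subset_of_card_le
      · exact Finset.subset_erase.2 ⟨(memQ T hT.1).2, hT.2⟩
      · rw [Finset.card_erase_of_mem hx, (memQ T hT.1).1.card_eq]
        omega
    intro T hT T' hT'
    rw [key T hT, key T' hT']
  obtain ⟨T, hT, hTn⟩ : ∃ T ∈ Q, T ∉ Q.filter (y ∉ ·) ∪ Q.filter (z ∉ ·) := by
    apply Finset.exists_mem_notMem_of_card_lt_card
    have := missing y hy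
    have := missing z hz
    have := Finset.card_union_le (Q.filter (y ∉ ·)) (Q.filter (z ∉ ·))
    omega
  simp only [Finset.mem_union, Finset.mem_filter, hT, true_and, not_or, not_not] at hTn
  exact (memQ T hT).1.isClique hTn.1 hTn.2 hyz

end Average

section Critical

variable {V : Type*} {G : SimpleGraph V} {m : ℕ}

theorem exists_isDefectColoring_of_isCritical (hG : IsCritical G (m + 1)) {u v : V}
    (huv : G.Adj u v) : ∃ c : V → Fin m, G.IsDefectColoring u v c := by
  have hne : (⊤ : G.Subgraph).deleteEdges {s(u, v)} ≠ ⊤ := by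
    intro h
    have : ((⊤ : G.Subgraph).deleteEdges {s(u, v)}).Adj u v := by
      rw [h]
      exact huv
    simp at this
  have hcol : ((⊤ : G.Subgraph).deleteEdges {s(u, v)}).coe.Colorable m :=
    chromaticNumber_le_iff_colorable.1 (Order.le_of_lt_add_one (by exact_mod_cast hG.2 _ hne))
  obtain ⟨C⟩ := hcol
  have mono : ∀ x y, G.Adj x y → C ⟨x, trivial⟩ = C ⟨y, trivial⟩ → s(x, y) = s(u, v) := by
    intro x y hxy h
    by_contra hs
    refine C.valid (v := ⟨x, trivial⟩) (w := ⟨y, trivial⟩) ?_ h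
    simp only [Subgraph.coe_adj, Subgraph.deleteEdges_adj, Subgraph.top_adj]
    exact ⟨hxy, hs⟩
  refine ⟨fun x => C ⟨x, trivial⟩, ?_, mono⟩
  by_contra hcuv
  have hGc : G.Colorable m := by
    refine ⟨Coloring.mk (fun x => C ⟨x, trivial⟩) fun {x y} hxy h => ?_⟩
    have := mono x y hxy h
    rw [Sym2.eq_iff] at this
    rcases this with ⟨rfl, rfl⟩ | ⟨rfl, rfl⟩
    · exact hcuv h
    · exact hcuv h.symm
  have := chromaticNumber_le_iff_colorable.2 hGc
  rw [hG.1] at this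
  have := ENat.natCast_le_natCast.1 this
  omega

theorem exists_coloring_off_vertex_of_isCritical (hG : IsCritical G (m + 1)) (hm : 0 < m) (w : V) :
    ∃ c : V → Fin m, ∀ x y, G.Adj x y → x ≠ w → y ≠ w → c x ≠ c y := by
  classical
  have hne : (⊤ : G.Subgraph).deleteVerts {w} ≠ ⊤ := by
    intro h
    have : w ∈ ((⊤ : G.Subgraph).deleteVerts {w}).verts := by
      rw [h]
      trivial
    simp at this
  have hcol : ((⊤ : G.Subgraph).deleteVerts {w}).coe.Colorable m :=
    chromaticNumber_le_iff_colorable.1 (Order.le_of_lt_add_one (by exact_mod_cast hG.2 _ hne))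
  obtain ⟨C⟩ := hcol
  have hmem : ∀ x, x ≠ w → x ∈ ((⊤ : G.Subgraph).deleteVerts {w}).verts := by
    intro x hx
    simp [hx]
  refine ⟨fun x => if h : x ≠ w then C ⟨x, hmem x h⟩ else ⟨0, hm⟩, fun x y hxy hx hy => ?_⟩
  simp only [hx, hy, ne_eq, not_false_eq_true, dif_pos]
  refine C.valid ?_
  simp [hx, hy, hxy]

theorem exists_adj_of_isCritical (hG : IsCritical G (m + 1)) (hm : 0 < m) (v : V) :
    ∃ u, G.Adj v u := by
  by_contra! h
  obtain ⟨c, hc⟩ := exists_coloring_off_vertex_of_isCritical hG hm v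
  have hGc : G.Colorable m := by
    refine ⟨Coloring.mk c fun {x y} hxy => hc x y hxy ?_ ?_⟩
    · rintro rfl
      exact h y hxy
    · rintro rfl
      exact h x hxy.symm
  have := chromaticNumber_le_iff_colorable.2 hGc
  rw [hG.1] at this
  have := ENat.natCast_le_natCast.1 this
  omega

theorem cliqueFree_of_isCritical [Fintype V] (hG : IsCritical G (m + 1)) (hm : 0 < m)
    (hcard : m + 1 < Fintype.card V) : G.CliqueFree (m + 1) := by
  intro S hS
  obtain ⟨w, -, hw⟩ := Finset.exists_mem_notMem_of_card_lt_card
    (s := S) (t := Finset.univ) (by rwa [hS.card_eq, Finset.card_univ])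
  obtain ⟨c, hc⟩ := exists_coloring_off_vertex_of_isCritical hG hm w
  obtain ⟨x, hx, y, hy, hxy, h⟩ := Finset.exists_ne_map_eq_of_card_lt_of_maps_to
    (s := S) (t := Finset.univ) (f := c) (by rw [hS.card_eq, Finset.card_fin]; omega)
    (fun _ _ => Finset.mem_coe.2 (Finset.mem_univ _))
  refine hc x y (hS.isClique hx hy hxy) ?_ ?_ h
  · rintro rfl
    exact hw hx
  · rintro rfl
    exact hw hy

end Critical

end SimpleGraph

/-- Su: for `4 ≤ k ≤ 7`, every `k`-critical graph on `n > k` vertices has an edge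
contained in at most one copy of `K_{k-1}`. -/
theorem su_edge_in_few_cliques {V : Type*} [Fintype V] {n k : ℕ} (hk4 : 4 ≤ k) (hk7 : k ≤ 7)
    (hn : k < n) (hcard : Fintype.card V = n) (G : SimpleGraph V) (hG : IsCritical G k) :
    ∃ u v : V, G.Adj u v ∧
      {s : Finset V | G.IsNClique (k - 1) s ∧ u ∈ s ∧ v ∈ s}.ncard ≤ 1 := by
  classical
  obtain ⟨m, rfl⟩ : ∃ m, k = m + 1 := ⟨k - 1, by omega⟩
  rw [Nat.add_sub_cancel]
  by_contra! hno
  have h2 : ∀ u v, G.Adj u v →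
      2 ≤ ((G.cliqueFinset m).filter fun T => u ∈ T ∧ v ∈ T).card := by
    intro u v huv
    have h := hno u v huv
    have hset : {s : Finset V | G.IsNClique m s ∧ u ∈ s ∧ v ∈ s} =
        ((G.cliqueFinset m).filter fun T => u ∈ T ∧ v ∈ T : Finset (Finset V)) := by
      ext T
      simp [mem_cliqueFinset_iff]
    rw [hset, Set.ncard_coe_finset] at h
    exact h
  have hE := fun u v (huv : G.Adj u v) => exists_isDefectColoring_of_isCritical hG huv
  have hiso := exists_adj_of_isCritical hG (by omega)
  have hfree := cliqueFree_of_isCritical hG (by omega) (by omega)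
  have : Nonempty V := Fintype.card_pos_iff.1 (by omega)
  have mem_of_le : ∀ v, ((G.cliqueFinset m).filter (v ∈ ·)).card ≤ 5 →
      ∀ T ∈ G.cliqueFinset m, v ∈ T := by
    intro v hv T hT
    rw [mem_cliqueFinset_iff] at hT
    by_contra hvT
    refine hfree (insert v T) (hT.insert fun x hx => ?_)
    have hvx : v ≠ x := fun h => hvT (h ▸ hx)
    obtain ⟨y, hy⟩ := hiso x
    obtain ⟨S, hS, hvS, hxS, -⟩ := exists_clique_of_card_le_five hE h2 (hiso v) hv hy
    exact ((mem_cliqueFinset_iff).1 hS).isClique hvS hxS hvx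
  obtain ⟨v, hv⟩ : ∃ v, ((G.cliqueFinset m).filter (v ∈ ·)).card ≤ 5 := by
    by_cases hm : 4 ≤ m
    · obtain ⟨v, hv⟩ := exists_card_cliques_through_lt hm hE hiso hfree
      exact ⟨v, by omega⟩
    · obtain ⟨v, -, hv⟩ := Finset.exists_le_of_sum_le (s := (Finset.univ : Finset V))
        (f := fun v => ((G.cliqueFinset m).filter (v ∈ ·)).card) (g := fun _ => 5)
        Finset.univ_nonempty (by
          rw [sum_card_cliques_through, Finset.sum_const, Finset.card_univ, smul_eq_mul]
          exact Nat.mul_le_mul (card_cliqueFinset_le_card (by omega) hE) (by omega))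
      exact ⟨v, hv⟩
  have hall : (G.cliqueFinset m).card ≤ 5 := by
    rwa [Finset.filter_true_of_mem (mem_of_le v hv)] at hv
  obtain ⟨u, hu⟩ := hiso v
  obtain ⟨T, hT⟩ := Finset.card_pos.1 (lt_of_lt_of_le Nat.zero_lt_two (h2 v u hu))
  rw [Finset.mem_filter] at hT
  have huniv : T = Finset.univ := Finset.eq_univ_of_forall fun w =>
    mem_of_le w ((Finset.card_filter_le _ _).trans hall) T hT.1
  have hTcard := ((mem_cliqueFinset_iff).1 hT.1).card_eq
  rw [huniv, Finset.card_univ] at hTcard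
  omega
end

section
/- Let k ≥ 4, let G be a graph with an edge uv, and let φ be a proper coloring of the graph G - uv (G with the edge uv deleted) using k-1 colors such that φ(u) = φ(v). Suppose that at most k-3 of the (k-1)-cliques of G contain both u and v. Then there exists a color c with c ≠ φ(u) such that every (k-1)-clique of G contains a vertex colored c under φ. -/
open SimpleGraph

/-- A coloring of `G - uv` is injective on every clique of `G` that misses `u` or `v`. -/
theorem SimpleGraph.IsClique.injOn_coloring_deleteEdges {V α : Type*} {G : SimpleGraph V}
    {u v : V} (φ : (G.deleteEdges {s(u, v)}).Coloring α) {s : Set V} (hs : G.IsClique s)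
    (huv : ¬ (u ∈ s ∧ v ∈ s)) : Set.InjOn φ s := by
  intro a ha b hb hab
  by_contra hne
  refine φ.valid ?_ hab
  rw [deleteEdges_adj]
  refine ⟨hs ha hb hne, fun h => huv ?_⟩
  rw [Set.mem_singleton_iff, Sym2.eq_iff] at h
  rcases h with ⟨rfl, rfl⟩ | ⟨rfl, rfl⟩
  exacts [⟨ha, hb⟩, ⟨hb, ha⟩]

/-- If `φ` is a proper `(k-1)`-coloring of `G - uv` with `φ(u) = φ(v)` and at most
`k - 3` of the `(k-1)`-cliques of `G` contain both `u` and `v`, then some color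
`c ≠ φ(u)` appears in every `(k-1)`-clique of `G`. -/
theorem exists_color_in_every_clique {V : Type*} [Fintype V] {k : ℕ} (hk : 4 ≤ k)
    (G : SimpleGraph V) (u v : V) (huv : G.Adj u v)
    (φ : (G.deleteEdges {s(u, v)}).Coloring (Fin (k - 1))) (hφ : φ u = φ v)
    (hfew : {s : Finset V | G.IsNClique (k - 1) s ∧ u ∈ s ∧ v ∈ s}.ncard ≤ k - 3) :
    ∃ c : Fin (k - 1), c ≠ φ u ∧
      ∀ s : Finset V, G.IsNClique (k - 1) s → ∃ w ∈ s, φ w = c := by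
  classical
  by_contra! hcon
  choose! f hf hfc using hcon
  have hmem (c) (hc : c ≠ φ u) : u ∈ f c ∧ v ∈ f c := by
    by_contra hnot
    have hinj := (hf c hc).isClique.injOn_coloring_deleteEdges φ (by simpa using hnot)
    have himage : (f c).image φ = Finset.univ := by
      rw [← Finset.card_eq_iff_eq_univ, Finset.card_image_of_injOn hinj, (hf c hc).card_eq,
        Fintype.card_fin]
    obtain ⟨w, hw, hwc⟩ := Finset.mem_image.mp (himage ▸ Finset.mem_univ c)
    exact hfc c hc w hw hwc
  have hfinj : Set.InjOn f {c | c ≠ φ u} := by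
    intro c hc d hd hcd
    by_contra hne
    have hclique : G.IsClique ((f c).erase u : Finset V) :=
      (hf c hc).isClique.subset (by simp)
    have hinj := hclique.injOn_coloring_deleteEdges φ (by simp)
    have hsub : ((f c).erase u).image φ ⊆ Finset.univ \ {c, d} := by
      intro x hx
      obtain ⟨w, hw, rfl⟩ := Finset.mem_image.mp hx
      have hw' := Finset.mem_of_mem_erase hw
      have hwd := hfc d hd w (hcd ▸ hw')
      simpa using ⟨hfc c hc w hw', hwd⟩
    have hcard := Finset.card_le_card hsub
    rw [Finset.card_image_of_injOn hinj, Finset.card_erase_of_mem (hmem c hc).1,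
      (hf c hc).card_eq, Finset.card_sdiff_of_subset (Finset.subset_univ _),
      Finset.card_pair hne, Finset.card_univ, Fintype.card_fin] at hcard
    omega
  have hle : {c | c ≠ φ u}.ncard ≤
      {s : Finset V | G.IsNClique (k - 1) s ∧ u ∈ s ∧ v ∈ s}.ncard :=
    Set.ncard_le_ncard_of_injOn f (fun c hc => ⟨hf c hc, hmem c hc⟩) hfinj (Set.toFinite _)
  have hcolors : {c | c ≠ φ u}.ncard = k - 1 - 1 := by
    rw [← Set.compl_singleton_eq, Set.ncard_compl, Set.ncard_singleton, Nat.card_fin]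
  omega
end

section
/- Let k ≥ 4 and let G be a k-critical graph on n vertices with t_{k-1}(G) ≤ n - 1. Then there exists a vertex u of G that is contained in at most k - 2 copies of K_{k-1}. -/
open SimpleGraph

/-- Double counting of incidences between vertices and copies of `K_ℓ`. -/
theorem sum_ncard_isNClique_mem {V : Type*} [Fintype V] (G : SimpleGraph V) (ℓ : ℕ) :
    ∑ u : V, {s : Finset V | G.IsNClique ℓ s ∧ u ∈ s}.ncard = cliqueCount G ℓ * ℓ := by
  classical
  have hcount : cliqueCount G ℓ = (G.cliqueFinset ℓ).card := by
    rw [cliqueCount, ← Set.ncard_coe_finset]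
    congr 1
    ext s
    simp
  have hmem (u : V) : {s : Finset V | G.IsNClique ℓ s ∧ u ∈ s}.ncard =
      ((G.cliqueFinset ℓ).filter (u ∈ ·)).card := by
    rw [← Set.ncard_coe_finset]
    congr 1
    ext s
    simp
  simp_rw [hmem, hcount]
  have hswap := Finset.sum_card_bipartiteAbove_eq_sum_card_bipartiteBelow
    (s := (Finset.univ : Finset V)) (t := G.cliqueFinset ℓ) (fun u s => u ∈ s)
  simp only [Finset.bipartiteAbove, Finset.bipartiteBelow, Finset.filter_univ_mem] at hswap
  rw [hswap]
  exact Finset.sum_const_nat fun s hs => (mem_cliqueFinset_iff.1 hs).card_eq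

/-- If a `k`-critical graph on `n` vertices (`k ≥ 4`) has at most `n - 1` copies of
`K_{k-1}`, then some vertex lies in at most `k - 2` copies of `K_{k-1}`. -/
theorem exists_vertex_in_few_cliques {V : Type*} [Fintype V] {n k : ℕ} (hk : 4 ≤ k)
    (hcard : Fintype.card V = n) (G : SimpleGraph V) (hG : IsCritical G k)
    (hfew : cliqueCount G (k - 1) ≤ n - 1) :
    ∃ u : V, {s : Finset V | G.IsNClique (k - 1) s ∧ u ∈ s}.ncard ≤ k - 2 := by
  by_contra! h
  have hne : Nonempty V := by
    by_contra hV
    rw [not_nonempty_iff] at hV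
    have h0 := hG.1
    rw [chromaticNumber_eq_zero_of_isEmpty] at h0
    have : (0 : ℕ) = k := by exact_mod_cast h0
    omega
  have hn : 0 < n := hcard ▸ Fintype.card_pos
  have hle : n * (k - 1) ≤ (n - 1) * (k - 1) := calc
    n * (k - 1) = ∑ _u : V, (k - 1) := by simp [hcard]
    _ ≤ ∑ u : V, {s : Finset V | G.IsNClique (k - 1) s ∧ u ∈ s}.ncard :=
      Finset.sum_le_sum fun u _ => by have := h u; omega
    _ = cliqueCount G (k - 1) * (k - 1) := sum_ncard_isNClique_mem G (k - 1)
    _ ≤ (n - 1) * (k - 1) := Nat.mul_le_mul_right _ hfew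
  have := Nat.le_of_mul_le_mul_right hle (by omega)
  omega
end

section
/- Let k ≥ 4 and let G be a k-critical graph. If the neighborhood of some vertex u of G induces a complete subgraph, then G is isomorphic to the complete graph K_k. -/
open SimpleGraph

/-- A graph of chromatic number less than `k` can be coloured with `k - 1` colours. -/
theorem colorable_pred_of_chromaticNumber_lt {W : Type*} {H : SimpleGraph W} {k : ℕ}
    (h : H.chromaticNumber < k) : H.Colorable (k - 1) := by
  obtain ⟨n, hn⟩ := ENat.ne_top_iff_exists.mp (ne_top_of_lt h)
  rw [← hn, Nat.cast_lt] at h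
  have hcol : H.Colorable n := chromaticNumber_le_iff_colorable.mp hn.symm.le
  exact hcol.mono (by omega)

/-- If a vertex deletion of `G` has a proper colouring in which some colour is missing on the
neighbours of the deleted vertex, then the colouring extends to `G`. -/
theorem colorable_of_missing_color {V : Type*} {G : SimpleGraph V} {u : V} {n : ℕ}
    (C : ((⊤ : G.Subgraph).induce {u}ᶜ).coe.Coloring (Fin n)) (c : Fin n)
    (hc : ∀ w (hw : w ≠ u), G.Adj u w → C ⟨w, hw⟩ ≠ c) : G.Colorable n := by
  classical
  refine ⟨Coloring.mk (fun w => if hw : w ≠ u then C ⟨w, hw⟩ else c) ?_⟩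
  intro v w hvw
  by_cases hv : v = u
  · subst hv
    have hw : w ≠ v := hvw.ne'
    simpa [hw] using (hc w hw hvw).symm
  · by_cases hw : w = u
    · subst hw
      simpa [hv] using hc v hv hvw.symm
    · simp only [ne_eq, hv, hw, not_false_eq_true, dite_true]
      exact C.valid (by simp [hv, hw, hvw])

/-- A `k`-critical graph that contains `k` pairwise adjacent vertices is complete. -/
theorem IsCritical.nonempty_iso_of_clique {V : Type*} {G : SimpleGraph V} {k : ℕ}
    (hk : 0 < k) (hG : IsCritical G k) (g : Fin k → V)
    (hg : ∀ a b, a ≠ b → G.Adj (g a) (g b)) : Nonempty (G ≃g completeGraph (Fin k)) := by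
  have hinj : Function.Injective g := fun a b hab => by
    by_contra hne
    exact (hg a b hne).ne hab
  have htop : (⊤ : G.Subgraph).induce (Set.range g) = ⊤ := by
    by_contra hne
    obtain ⟨C⟩ := colorable_pred_of_chromaticNumber_lt (hG.2 _ hne)
    have hC : Function.Injective fun a => C ⟨g a, Set.mem_range_self a⟩ := fun a b hab => by
      by_contra hne
      exact C.valid (by simp [hg a b hne]) hab
    have := Fintype.card_le_of_injective _ hC
    simp only [Fintype.card_fin] at this
    omega
  have hsurj : Function.Surjective g := fun v => by
    have hv : v ∈ ((⊤ : G.Subgraph).induce (Set.range g)).verts := by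
      rw [htop]; trivial
    exact hv
  refine ⟨RelIso.symm ⟨Equiv.ofBijective g ⟨hinj, hsurj⟩, ?_⟩⟩
  intro a b
  exact ⟨fun h => by rintro rfl; exact h.ne rfl, fun h => hg a b h⟩

/-- If the neighborhood of some vertex of a `k`-critical graph (`k ≥ 4`) induces a
complete subgraph, then the graph is isomorphic to `K_k`. -/
theorem critical_simplicial_vertex {V : Type*} {k : ℕ} (hk : 4 ≤ k)
    (G : SimpleGraph V) (hG : IsCritical G k) (u : V)
    (hnbr : G.IsClique (G.neighborSet u)) :
    Nonempty (G ≃g completeGraph (Fin k)) := by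
  obtain ⟨n, rfl⟩ : ∃ n, k = n + 1 := ⟨k - 1, by omega⟩
  have hne : (⊤ : G.Subgraph).induce {u}ᶜ ≠ ⊤ := fun h => by
    have hu : u ∈ ((⊤ : G.Subgraph).induce {u}ᶜ).verts := by
      rw [h]; trivial
    exact hu rfl
  obtain ⟨C⟩ : ((⊤ : G.Subgraph).induce {u}ᶜ).coe.Colorable n :=
    colorable_pred_of_chromaticNumber_lt (hG.2 _ hne)
  have hall : ∀ c, ∃ w, ∃ hw : w ≠ u, G.Adj u w ∧ C ⟨w, hw⟩ = c := by
    intro c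
    by_contra! hc
    have hle := (colorable_of_missing_color C c hc).chromaticNumber_le
    rw [hG.1, Nat.cast_le] at hle
    omega
  choose f hfu hadj hcol using hall
  have hf : ∀ a b, a ≠ b → G.Adj (f a) (f b) := fun a b hab => by
    refine hnbr (hadj a) (hadj b) fun h => hab ?_
    rw [← hcol a, ← hcol b]
    simp only [h]
  refine hG.nonempty_iso_of_clique n.succ_pos (Fin.cons u f) fun a b hab => ?_
  cases a using Fin.cases <;> cases b using Fin.cases
  · exact absurd rfl hab
  · exact hadj _
  · exact (hadj _).symm
  · exact hf _ _ fun h => hab (congrArg Fin.succ h)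
end
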